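/- arXiv:2506.00529 — 2 statements merged into one kernel-verified Lean document; each statement's English description precedes it below -/
import Mathlib

section
/- Let (R, 𝔪) be a commutative Noetherian local ring with residue field k and r ≥ 1. Let S = ⊕_{n∈ℕ^r} S_n be a Noetherian standard ℕ^r-graded ring with S_0 = R, and let ℳ = ⊕_{n∈ℤ^r} ℳ_n be a finitely generated ℤ^r-graded S-module. Let f : K → L be an R-linear map between finitely generated R-modules and let F denote the associated coherent functor, F(X) := Hom_R(K,X) / {g ∘ f : g ∈ Hom_R(L,X)}. Fix i ≥ 0. Then there exist c ∈ ℕ^r and a polynomial P ∈ ℚ[x_1,…,x_r] such that μ_R^i(F(ℳ_n)) = P(n) for all n ∈ ℤ^r with n ≥ c. -/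
universe u

open CategoryTheory

/-- The value of the coherent functor presented by `f : K →ₗ[R] L` on a module `X`:
`F(X) = Hom_R(K, X) / {g ∘ f : g ∈ Hom_R(L, X)}`. -/
abbrev coherentApply {R K L : Type u} [CommRing R] [AddCommGroup K] [Module R K]
    [AddCommGroup L] [Module R L] (f : K →ₗ[R] L)
    (X : Type u) [AddCommGroup X] [Module R X] : Type u :=
  (K →ₗ[R] X) ⧸ LinearMap.range (LinearMap.lcomp R X f)

/-- The length `λ_R(X)` of an `R`-module `X`. -/
noncomputable def moduleLength (R X : Type u) [CommRing R] [AddCommGroup X]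
    [Module R X] : WithBot ℕ∞ :=
  Order.krullDim (Submodule R X)

/-- The `i`-th Bass number of `X` over a local ring `(R,𝔪,k)`:
`μ_R^i(X) = dim_k Ext_R^i(k, X)`, computed as the `R`-length of `Ext_R^i(k, X)`
(which coincides with its `k`-dimension since `𝔪` annihilates this module). -/
noncomputable def bassNumber (R : Type u) [CommRing R] [IsLocalRing R] (i : ℕ)
    (X : Type u) [AddCommGroup X] [Module R X] : WithBot ℕ∞ :=
  moduleLength R
    ↥(((Ext R (ModuleCat.{u} R) i).obj
        (Opposite.op (ModuleCat.of R (IsLocalRing.ResidueField R)))).obj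
      (ModuleCat.of R X))


namespace HilbAux

open MvPolynomial in
lemma exists_antidiff {r : ℕ} (j : Fin r) (P : MvPolynomial (Fin r) ℚ) :
    ∃ Q : MvPolynomial (Fin r) ℚ, ∀ n : Fin r → ℤ,
      eval (fun i => (((n + Pi.single j 1 : Fin r → ℤ) i : ℤ) : ℚ)) Q - eval (fun i => (n i : ℚ)) Q
        = eval (fun i => (n i : ℚ)) P := by
  induction P using MvPolynomial.induction_on' with
  | monomial m a =>
    refine ⟨monomial (m.erase j) (a / (m j + 1)) *
      Polynomial.aeval (X j) (Polynomial.bernoulli (m j + 1)), fun n => ?_⟩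
    have h1 : ∀ (v : Fin r → ℚ), eval v (Polynomial.aeval (X j : MvPolynomial (Fin r) ℚ)
        (Polynomial.bernoulli (m j + 1))) = (Polynomial.bernoulli (m j + 1)).eval (v j) := by
      intro v
      have := Polynomial.aeval_algHom_apply (MvPolynomial.aeval v : MvPolynomial (Fin r) ℚ →ₐ[ℚ] ℚ)
        (X j) (Polynomial.bernoulli (m j + 1))
      simp only [MvPolynomial.aeval_X, Polynomial.coe_aeval_eq_eval] at this
      rw [this]
      simp [MvPolynomial.aeval_eq_eval]
    have h2 : ∀ (v w : Fin r → ℚ), (∀ i, i ≠ j → v i = w i) → 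
      eval v (monomial (m.erase j) (a / (m j + 1))) = eval w (monomial (m.erase j) (a / (m j + 1))) := by
      intro v w h
      rw [eval_monomial, eval_monomial]
      congr 1
      apply Finsupp.prod_congr
      intro i hi
      rw [h i]
      rintro rfl
      simp at hi
    rw [map_mul, map_mul, h1, h1, h2 _ (fun i => (n i : ℚ))
      (by intro i hi; simp [hi])]
    rw [show (((n + Pi.single j 1 : Fin r → ℤ) j : ℤ) : ℚ) = 1 + (n j : ℚ) by simp [add_comm]]
    rw [Polynomial.bernoulli_eval_one_add, eval_monomial, eval_monomial]
    conv_rhs => rw [← Finsupp.mul_prod_erase' m j _ (by simp)]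
    have : ((m j : ℚ) + 1) ≠ 0 := by positivity
    simp only [Nat.add_sub_cancel]
    push_cast
    field_simp
    ring
  | add p q hp hq =>
    obtain ⟨Q1, h1⟩ := hp
    obtain ⟨Q2, h2⟩ := hq
    refine ⟨Q1 + Q2, fun n => ?_⟩
    simp only [map_add, ← h1 n, ← h2 n]
    ring

open MvPolynomial in
lemma poly_of_diff {r : ℕ} (H : (Fin r → ℤ) → ℚ) (c : Fin r → ℤ)
    (P : Fin r → MvPolynomial (Fin r) ℚ)
    (h : ∀ j, ∀ n, c ≤ n → H (n + Pi.single j 1) - H n = eval (fun i => (n i : ℚ)) (P j)) :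
    ∃ Q : MvPolynomial (Fin r) ℚ, ∀ n, c ≤ n → H n = eval (fun i => (n i : ℚ)) Q := by
  classical
  choose A hA using fun j => exists_antidiff j (P j)
  -- substitution of constants
  let sub : Finset (Fin r) → MvPolynomial (Fin r) ℚ → MvPolynomial (Fin r) ℚ := fun T Q =>
    bind₁ (fun i => if i ∈ T then C (c i : ℚ) else X i) Q
  let pt : Finset (Fin r) → (Fin r → ℤ) → (Fin r → ℤ) := fun T n i => if i ∈ T then c i else n i
  have hsub : ∀ T Q n, eval (fun i => (n i : ℚ)) (sub T Q) = eval (fun i => (pt T n i : ℚ)) Q := by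
    intro T Q n
    simp only [sub, pt]
    rw [← MvPolynomial.coe_aeval_eq_eval, ← MvPolynomial.coe_aeval_eq_eval]
    simp only [RingHom.coe_coe]
    rw [aeval_bind₁]
    congr 2
    ext i
    split_ifs <;> simp
  -- one coordinate
  have hone : ∀ j n, c ≤ n → H n = H (Function.update n j (c j)) +
      (eval (fun i => (n i : ℚ)) (A j) -
        eval (fun i => (Function.update n j (c j) i : ℚ)) (A j)) := by
    intro j n hn
    obtain ⟨t, ht⟩ : ∃ t : ℕ, n j = c j + t := ⟨(n j - c j).toNat, by have : c j ≤ n j := hn j; omega⟩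
    induction t generalizing n with
    | zero => 
      have : Function.update n j (c j) = n := by
        rw [Function.update_eq_self_iff]; simp [ht]
      rw [this]; simp
    | succ t ih =>
      have hn' : c ≤ n - Pi.single j 1 := by
        intro i
        by_cases hi : i = j
        · subst hi; simp [ht]
        · simpa [hi] using hn i
      have h1 := ih (n - Pi.single j 1) hn' (by simp [ht]; ring)
      have h2 := h j _ hn'
      have h3 := hA j (n - Pi.single j 1)
      have h4 : Function.update (n - Pi.single j 1) j (c j) = Function.update n j (c j) := by
        ext i
        by_cases hi : i = j
        · subst hi; simp
        · simp [hi]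
      rw [sub_add_cancel] at h2 h3
      rw [h4] at h1
      linarith
  have key : ∀ T : Finset (Fin r), ∃ Q : MvPolynomial (Fin r) ℚ, ∀ n, c ≤ n →
      H n = H (pt T n) + eval (fun i => (n i : ℚ)) Q := by
    intro T
    induction T using Finset.induction_on with
    | empty => exact ⟨0, fun n hn => by simp [pt]⟩
    | insert j T hj ih =>
      obtain ⟨Q, hQ⟩ := ih
      refine ⟨Q + (sub T (A j) - sub (insert j T) (A j)), fun n hn => ?_⟩
      have hle : c ≤ pt T n := by
        intro i
        simp only [pt]
        split_ifs
        · exact le_rfl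
        · exact hn i
      have hup : Function.update (pt T n) j (c j) = pt (insert j T) n := by
        ext i
        by_cases hi : i = j
        · subst hi; simp [pt]
        · simp [pt, hi]
      rw [hQ n hn, hone j _ hle, hup]
      simp only [map_add, map_sub, hsub]
      ring
  obtain ⟨Q, hQ⟩ := key Finset.univ
  refine ⟨C (H c) + Q, fun n hn => ?_⟩
  rw [hQ n hn]
  have : pt Finset.univ n = c := by ext i; simp [pt]
  simp [this]

end HilbAux
namespace HilbAux

lemma length_four {R A B C D : Type*} [Ring R] [AddCommGroup A] [AddCommGroup B] [AddCommGroup C]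
    [AddCommGroup D] [Module R A] [Module R B] [Module R C] [Module R D]
    (a : A →ₗ[R] B) (b : B →ₗ[R] C) (d : C →ₗ[R] D) (ha : Function.Injective a)
    (hab : Function.Exact a b) (hbd : Function.Exact b d) (hd : Function.Surjective d) :
    Module.length R A + Module.length R C = Module.length R B + Module.length R D := by
  have h1 := Module.length_eq_add_of_exact a b.rangeRestrict ha b.surjective_rangeRestrict
    (by
      intro y
      rw [← hab y]
      exact Subtype.ext_iff)
  have h2 := Module.length_eq_add_of_exact (LinearMap.range b).subtype d
    (Submodule.subtype_injective _) hd
    (by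
      intro y
      rw [hbd y]
      simp)
  rw [h1, h2]
  ring

lemma length_graded {R N' N N'' : Type*} [CommRing R] [AddCommGroup N'] [AddCommGroup N]
    [AddCommGroup N''] [Module R N'] [Module R N] [Module R N'']
    (i : N' →ₗ[R] N) (y : N →ₗ[R] N) (q : N →ₗ[R] N'') (hi : Function.Injective i)
    (hiy : Function.Exact i y) (hyq : Function.Exact y q) (hq : Function.Surjective q)
    (π' : N' →ₗ[R] N') (π₁ π₂ : N →ₗ[R] N) (π'' : N'' →ₗ[R] N'')
    (h1 : ∀ v, π₁ (π₁ v) = π₁ v) (h2 : ∀ v, π₂ (π₂ v) = π₂ v)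
    (c1 : ∀ v, i (π' v) = π₁ (i v)) (c2 : ∀ v, y (π₁ v) = π₂ (y v))
    (c3 : ∀ v, q (π₂ v) = π'' (q v)) :
    Module.length R (LinearMap.range π') + Module.length R (LinearMap.range π₂) =
      Module.length R (LinearMap.range π₁) + Module.length R (LinearMap.range π'') := by
  refine length_four
    (i.restrict (p := LinearMap.range π') (q := LinearMap.range π₁) ?_)
    (y.restrict (p := LinearMap.range π₁) (q := LinearMap.range π₂) ?_)
    (q.restrict (p := LinearMap.range π₂) (q := LinearMap.range π'') ?_) ?_ ?_ ?_ ?_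
  · rintro _ ⟨v, rfl⟩; exact ⟨i v, (c1 v).symm⟩
  · rintro _ ⟨v, rfl⟩; exact ⟨y v, (c2 v).symm⟩
  · rintro _ ⟨v, rfl⟩; exact ⟨q v, (c3 v).symm⟩
  · rintro ⟨v, hv⟩ ⟨w, hw⟩ h
    have := Subtype.ext_iff.1 h
    exact Subtype.ext (hi this)
  · rintro ⟨v, hv⟩
    constructor
    · intro h
      have h : y v = 0 := Subtype.ext_iff.1 h
      obtain ⟨w, rfl⟩ := (hiy v).1 h
      refine ⟨⟨π' w, w, rfl⟩, Subtype.ext ?_⟩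
      change i (π' w) = i w
      obtain ⟨u, hu⟩ := hv
      rw [c1, ← hu, h1]
    · rintro ⟨⟨w, hw⟩, h⟩
      have h : i w = v := Subtype.ext_iff.1 h
      exact Subtype.ext ((hiy v).2 ⟨w, h⟩)
  · rintro ⟨v, hv⟩
    constructor
    · intro h
      have h : q v = 0 := Subtype.ext_iff.1 h
      obtain ⟨w, rfl⟩ := (hyq v).1 h
      refine ⟨⟨π₁ w, w, rfl⟩, Subtype.ext ?_⟩
      change y (π₁ w) = y w
      obtain ⟨u, hu⟩ := hv
      rw [c2, ← hu, h2]
    · rintro ⟨⟨w, hw⟩, h⟩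
      have h : y w = v := Subtype.ext_iff.1 h
      exact Subtype.ext ((hyq v).2 ⟨w, h⟩)
  · rintro ⟨_, ⟨v, rfl⟩⟩
    obtain ⟨w, rfl⟩ := hq v
    exact ⟨⟨π₂ w, w, rfl⟩, Subtype.ext (c3 w)⟩

/-- If no variable moves in direction `j`, the graded pieces vanish eventually. -/
lemma vanish {R S : Type*} [CommRing R] [CommRing S] [Algebra R S] {r : ℕ} {σ : Type*}
    (x : σ → S) (deg : σ → Fin r) (hgen : Algebra.adjoin R (Set.range x) = ⊤)
    (N : Type*) [AddCommGroup N] [Module R N] [Module S N] [IsScalarTower R S N]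
    [IsNoetherian S N] (π : (Fin r → ℤ) → N →ₗ[R] N)
    (hidem : ∀ n v, π n (π n v) = π n v) (horth : ∀ n m v, n ≠ m → π n (π m v) = 0)
    (hx : ∀ s n v, π (n + Pi.single (deg s) 1) (x s • v) = x s • π n v)
    (j : Fin r) (hj : ∀ s, deg s = j → ∀ v : N, x s • v = 0) :
    ∃ t : ℤ, ∀ n, t < n j → ∀ v, π n v = 0 := by
  let W : ℕ → Submodule S N := fun t =>
    { carrier := {v | ∀ n : Fin r → ℤ, (t : ℤ) < n j → π n v = 0}
      add_mem' := by
        intro a b ha hb n hn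
        rw [map_add, ha n hn, hb n hn, add_zero]
      zero_mem' := by intro n hn; simp
      smul_mem' := by
        intro s
        have hs : s ∈ Algebra.adjoin R (Set.range x) := by rw [hgen]; trivial
        induction hs using Algebra.adjoin_induction with
        | mem s hs =>
          obtain ⟨s, rfl⟩ := hs
          intro v hv n hn
          by_cases h : deg s = j
          · rw [hj s h, map_zero]
          · have := hx s (n - Pi.single (deg s) 1) v
            rw [sub_add_cancel] at this
            rw [this, hv, smul_zero]
            simpa [Ne.symm h] using hn
        | algebraMap a =>
          intro v hv n hn
          rw [algebraMap_smul, map_smul, hv n hn, smul_zero]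
        | add a b _ _ ha hb =>
          intro v hv n hn
          rw [add_smul, map_add, ha hv n hn, hb hv n hn, add_zero]
        | mul a b _ _ ha hb =>
          intro v hv
          rw [mul_smul]
          exact ha (hb hv) }
  have hW : Monotone W := by
    intro a b hab v hv n hn
    exact hv n (lt_of_le_of_lt (by exact_mod_cast hab) hn)
  obtain ⟨t, ht⟩ := monotone_stabilizes_iff_noetherian.2 ‹IsNoetherian S N› ⟨W, hW⟩
  refine ⟨t, fun n hn v => ?_⟩
  have h1 : π n v ∈ W (n j).toNat := by
    intro m hm
    apply horth
    rintro rfl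
    omega
  have h2 : W t = W (n j).toNat := ht (n j).toNat (by omega)
  rw [← h2] at h1
  rw [← hidem]
  exact h1 n hn

theorem hilbert {R S : Type u} [CommRing R] [CommRing S] [Algebra R S] {r : ℕ} {σ : Type*}
    (x : σ → S) (deg : σ → Fin r) (hgen : Algebra.adjoin R (Set.range x) = ⊤) (k : ℕ) :
    ∀ (T : Finset σ), T.card = k → ∀
    (N : Type u) [AddCommGroup N] [Module R N] [Module S N] [IsScalarTower R S N]
    [IsNoetherian S N] (π : (Fin r → ℤ) → N →ₗ[R] N)
    (_hidem : ∀ n v, π n (π n v) = π n v) (_horth : ∀ n m v, n ≠ m → π n (π m v) = 0)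
    (_hx : ∀ s n v, π (n + Pi.single (deg s) 1) (x s • v) = x s • π n v)
    (_hT : ∀ s, s ∉ T → ∀ v : N, x s • v = 0)
    (_hfin : ∀ n, Module.length R (LinearMap.range (π n)) ≠ ⊤),
    ∃ (c : Fin r → ℤ) (P : MvPolynomial (Fin r) ℚ), ∀ n, c ≤ n →
      ((Module.length R (LinearMap.range (π n))).toNat : ℚ) =
        MvPolynomial.eval (fun i => (n i : ℚ)) P := by
  classical
  induction k with
  | zero =>
    intro T hTc N _ _ _ _ _ π hidem horth hx hT hfin
    obtain rfl := Finset.card_eq_zero.1 hTc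
    by_cases hr : Nonempty (Fin r)
    · obtain ⟨j⟩ := hr
      obtain ⟨t, ht⟩ := vanish x deg hgen N π hidem horth hx j (fun s _ => hT s (by simp))
      refine ⟨fun _ => t + 1, 0, fun n hn => ?_⟩
      have : π n = 0 := by
        ext v
        exact ht n (by have : t + 1 ≤ n j := hn j; omega) v
      rw [this, LinearMap.range_zero, Module.length_bot]
      simp
    · have : IsEmpty (Fin r) := not_nonempty_iff.1 hr
      refine ⟨0, MvPolynomial.C ((Module.length R (LinearMap.range (π 0))).toNat : ℚ), fun n hn => ?_⟩
      rw [MvPolynomial.eval_C]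
      rw [Subsingleton.elim n 0]
  | succ k ih =>
    intro T hTc N _ _ _ _ _ π hidem horth hx hT hfin
    by_cases hall : ∀ j, ∃ s ∈ T, deg s = j
    · have hstep : ∀ j, ∃ (c : Fin r → ℤ) (P : MvPolynomial (Fin r) ℚ), ∀ n, c ≤ n →
          ((Module.length R (LinearMap.range (π (n + Pi.single j 1)))).toNat : ℚ) -
            ((Module.length R (LinearMap.range (π n))).toNat : ℚ) =
            MvPolynomial.eval (fun i => (n i : ℚ)) P := by
        intro j
        obtain ⟨s, hsT, rfl⟩ := hall j
        have hcard : (T.erase s).card = k := by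
          rw [Finset.card_erase_of_mem hsT, hTc]; rfl
        let y : N →ₗ[S] N := LinearMap.lsmul S N (x s)
        have hy : ∀ v, y v = x s • v := fun v => rfl
        have hyπ : ∀ n v, y (π n v) = π (n + Pi.single (deg s) 1) (y v) := fun n v => (hx s n v).symm
        -- kernel
        let N' := LinearMap.ker y
        let π' : (Fin r → ℤ) → N' →ₗ[R] N' := fun n =>
          { toFun := fun v => ⟨π n v.1, by
              rw [LinearMap.mem_ker, hyπ, LinearMap.mem_ker.1 v.2, map_zero]⟩
            map_add' := fun a b => Subtype.ext (by simp)
            map_smul' := fun a b => Subtype.ext (by simp) }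
        have hπ' : ∀ n v, ((π' n v : N') : N) = π n v := fun n v => rfl
        -- cokernel
        let N'' := N ⧸ LinearMap.range y
        have hmap : ∀ n, ∀ v ∈ LinearMap.range y, π n v ∈ LinearMap.range y := by
          rintro n _ ⟨w, rfl⟩
          have := hyπ (n - Pi.single (deg s) 1) w
          rw [sub_add_cancel] at this
          exact ⟨_, this⟩
        let e := Submodule.Quotient.restrictScalarsEquiv R (LinearMap.range y)
        let π'' : (Fin r → ℤ) → N'' →ₗ[R] N'' := fun n =>
          e.toLinearMap ∘ₗ (Submodule.mapQ ((LinearMap.range y).restrictScalars R)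
            ((LinearMap.range y).restrictScalars R) (π n) (hmap n)) ∘ₗ e.symm.toLinearMap
        let q : N →ₗ[S] N'' := (LinearMap.range y).mkQ
        have hqs : Function.Surjective q := Submodule.mkQ_surjective _
        have hπ'' : ∀ n v, π'' n (q v) = q (π n v) := fun n v => rfl
        have hlen : ∀ n, Module.length R (LinearMap.range (π' n)) +
            Module.length R (LinearMap.range (π (n + Pi.single (deg s) 1))) =
            Module.length R (LinearMap.range (π n)) +
            Module.length R (LinearMap.range (π'' (n + Pi.single (deg s) 1))) := by
          intro n
          refine length_graded (N'.subtype.restrictScalars R) (y.restrictScalars R)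
            (q.restrictScalars R) (Submodule.subtype_injective _) ?_ ?_ hqs _ _ _ _
            (hidem n) (hidem _) (fun v => rfl) (hyπ n) (fun v => (hπ'' _ v).symm)
          · exact LinearMap.exact_subtype_ker_map y
          · exact LinearMap.exact_map_mkQ_range y
        have hfin' : ∀ n, Module.length R (LinearMap.range (π' n)) ≠ ⊤ := by
          intro n
          refine ne_top_of_le_ne_top (hfin n) (Module.length_le_of_injective
            ((N'.subtype.restrictScalars R).restrict (p := LinearMap.range (π' n))
              (q := LinearMap.range (π n)) ?_) ?_)
          · rintro _ ⟨v, rfl⟩; exact ⟨v, rfl⟩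
          · rintro ⟨v, hv⟩ ⟨w, hw⟩ h
            have := Subtype.ext_iff.1 h
            exact Subtype.ext (Subtype.ext this)
        have hfin'' : ∀ n, Module.length R (LinearMap.range (π'' n)) ≠ ⊤ := by
          intro n
          refine ne_top_of_le_ne_top (hfin n) (Module.length_le_of_surjective
            ((q.restrictScalars R).restrict (p := LinearMap.range (π n))
              (q := LinearMap.range (π'' n)) ?_) ?_)
          · rintro _ ⟨v, rfl⟩; exact ⟨q v, rfl⟩
          · rintro ⟨_, ⟨v, rfl⟩⟩
            obtain ⟨w, rfl⟩ := hqs v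
            exact ⟨⟨π n w, w, rfl⟩, Subtype.ext rfl⟩
        obtain ⟨c', P', hP'⟩ := ih (T.erase s) hcard N' π'
          (fun n v => Subtype.ext (hidem n v)) (fun n m v h => Subtype.ext (horth n m v h))
          (fun s n v => Subtype.ext (hx s n v))
          (by
            intro a ha v
            apply Subtype.ext
            by_cases has : a = s
            · subst has; exact v.2
            · exact hT a (fun h => ha (Finset.mem_erase.2 ⟨has, h⟩)) v.1)
          hfin'
        obtain ⟨c'', P'', hP''⟩ := ih (T.erase s) hcard N'' π''
          (by
            intro n v
            obtain ⟨w, rfl⟩ := hqs v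
            rw [hπ'', hπ'', hidem])
          (by
            intro n m v h
            obtain ⟨w, rfl⟩ := hqs v
            rw [hπ'', hπ'', horth n m w h, map_zero])
          (by
            intro a n v
            obtain ⟨w, rfl⟩ := hqs v
            rw [hπ'', ← map_smul, hπ'', hx, map_smul])
          (by
            intro a ha v
            obtain ⟨w, rfl⟩ := hqs v
            rw [← map_smul]
            by_cases has : a = s
            · subst has
              exact (Submodule.Quotient.mk_eq_zero _).2 ⟨w, rfl⟩
            · rw [hT a (fun h => ha (Finset.mem_erase.2 ⟨has, h⟩)) w, map_zero])
          hfin''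
        refine ⟨c' ⊔ c'', MvPolynomial.bind₁ (fun i => MvPolynomial.X i +
          MvPolynomial.C ((Pi.single (deg s) 1 : Fin r → ℚ) i)) P'' - P', fun n hn => ?_⟩
        have hle1 : c' ≤ n := le_trans le_sup_left hn
        have hle2 : c'' ≤ n + Pi.single (deg s) 1 := by
          refine le_trans le_sup_right (le_trans hn ?_)
          rw [le_add_iff_nonneg_right]
          exact Pi.single_nonneg.2 zero_le_one
        have e1 := hP' n hle1
        have e2 := hP'' _ hle2
        have e3 := congrArg ENat.toNat (hlen n)
        rw [ENat.toNat_add (hfin' _) (hfin _), ENat.toNat_add (hfin _) (hfin'' _)] at e3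
        have e4 : MvPolynomial.eval (fun i => (n i : ℚ)) (MvPolynomial.bind₁ (fun i =>
            MvPolynomial.X i + MvPolynomial.C ((Pi.single (deg s) 1 : Fin r → ℚ) i)) P'') =
            MvPolynomial.eval (fun i => (((n + Pi.single (deg s) 1 : Fin r → ℤ) i : ℤ) : ℚ)) P'' := by
          rw [← MvPolynomial.coe_aeval_eq_eval, ← MvPolynomial.coe_aeval_eq_eval]
          simp only [RingHom.coe_coe]
          rw [MvPolynomial.aeval_bind₁]
          congr 2
          ext i
          by_cases hi : i = deg s
          · subst hi; simp
          · simp [hi]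
        rw [map_sub, e4, ← e1, ← e2]
        have e5 := congrArg (Nat.cast : ℕ → ℚ) e3
        push_cast at e5
        linarith
      choose c P hP using hstep
      by_cases hr : Nonempty (Fin r)
      · have hle : ∀ j, c j ≤ Finset.univ.sup' Finset.univ_nonempty c := fun j =>
          Finset.le_sup' c (Finset.mem_univ j)
        obtain ⟨Q, hQ⟩ := poly_of_diff
          (fun n => ((Module.length R (LinearMap.range (π n))).toNat : ℚ))
          (Finset.univ.sup' Finset.univ_nonempty c) P
          (fun j n hn => hP j n ((hle j).trans hn))
        exact ⟨_, Q, hQ⟩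
      · have : IsEmpty (Fin r) := not_nonempty_iff.1 hr
        refine ⟨0, MvPolynomial.C ((Module.length R (LinearMap.range (π 0))).toNat : ℚ), fun n hn => ?_⟩
        rw [MvPolynomial.eval_C]
        rw [Subsingleton.elim n 0]
    · push Not at hall
      obtain ⟨j, hj⟩ := hall
      obtain ⟨t, ht⟩ := vanish x deg hgen N π hidem horth hx j
        (fun s hs => hT s (fun h => hj s h hs))
      refine ⟨fun _ => t + 1, 0, fun n hn => ?_⟩
      have : π n = 0 := by
        ext v
        exact ht n (by have : t + 1 ≤ n j := hn j; omega) v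
      rw [this, LinearMap.range_zero, Module.length_bot]
      simp

end HilbAux
namespace HilbAux

lemma length_ne_top_of_killed {R M : Type*} [CommRing R] [IsLocalRing R] [AddCommGroup M]
    [Module R M] [Module.Finite R M]
    (h : ∀ a ∈ IsLocalRing.maximalIdeal R, ∀ v : M, a • v = 0) : Module.length R M ≠ ⊤ := by
  have hM : Module.IsTorsionBySet R M (IsLocalRing.maximalIdeal R : Set R) :=
    fun v a => h a.1 a.2 v
  letI : Module (R ⧸ IsLocalRing.maximalIdeal R) M := hM.module
  haveI : IsScalarTower R (R ⧸ IsLocalRing.maximalIdeal R) M :=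
    Module.IsTorsionBySet.isScalarTower hM
  letI : Field (R ⧸ IsLocalRing.maximalIdeal R) := Ideal.Quotient.field _
  haveI : Module.Finite (R ⧸ IsLocalRing.maximalIdeal R) M :=
    Module.Finite.of_restrictScalars_finite R _ M
  rw [Module.length_eq_of_surjective (R := R ⧸ IsLocalRing.maximalIdeal R)
    (Ideal.Quotient.mk_surjective)]
  exact Module.length_ne_top

lemma component_finite {R S : Type*} [CommRing R] [CommRing S] [Algebra R S] {r : ℕ} {σ : Type*}
    (x : σ → S) (deg : σ → Fin r) (hgen : Algebra.adjoin R (Set.range x) = ⊤)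
    (N : Type*) [AddCommGroup N] [Module R N] [Module S N] [IsScalarTower R S N]
    [IsNoetherian S N] (π : (Fin r → ℤ) → N →ₗ[R] N)
    (hidem : ∀ n v, π n (π n v) = π n v) (horth : ∀ n m v, n ≠ m → π n (π m v) = 0)
    (hx : ∀ s n v, π (n + Pi.single (deg s) 1) (x s • v) = x s • π n v) (n : Fin r → ℤ) :
    IsNoetherian R (LinearMap.range (π n)) := by
  have hmon : ∀ s ∈ Submonoid.closure (Set.range x), ∃ d : Fin r → ℤ, 0 ≤ d ∧
      (∀ n v, π (n + d) (s • v) = s • π n v) ∧ (s = 1 ∨ d ≠ 0) := by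
    intro s hs
    induction hs using Submonoid.closure_induction with
    | mem s hs =>
      obtain ⟨s, rfl⟩ := hs
      exact ⟨Pi.single (deg s) 1, Pi.single_nonneg.2 zero_le_one, hx s, Or.inr (by simp)⟩
    | one => exact ⟨0, le_rfl, by simp, Or.inl rfl⟩
    | mul a b _ _ ha hb =>
      obtain ⟨d, hd, h1, h2⟩ := ha
      obtain ⟨d', hd', h1', h2'⟩ := hb
      refine ⟨d' + d, add_nonneg hd' hd, ?_, ?_⟩
      · intro n v
        rw [mul_smul, ← add_assoc, h1, h1', mul_smul]
      · by_cases hz : d' + d = 0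
        · obtain ⟨e1, e2⟩ := (add_eq_zero_iff_of_nonneg hd' hd).1 hz
          left
          rw [h2.resolve_right (by simp [e2]), h2'.resolve_right (by simp [e1]), one_mul]
        · exact Or.inr hz
  have hs : ∀ s : S, ∃ a : R, ∀ v, π n (s • π n v) = a • π n v := by
    intro s
    have hs : s ∈ Submodule.span R (Submonoid.closure (Set.range x) : Set S) := by
      rw [← Algebra.adjoin_eq_span, hgen]; trivial
    induction hs using Submodule.span_induction with
    | mem s hs =>
      obtain ⟨d, hd, h1, h2⟩ := hmon s hs
      by_cases hs1 : s = 1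
      · exact ⟨1, fun v => by rw [hs1, one_smul, one_smul, hidem]⟩
      · refine ⟨0, fun v => ?_⟩
        have := h1 (n - d) (π n v)
        rw [sub_add_cancel] at this
        rw [this, zero_smul, horth, smul_zero]
        intro h
        exact h2.resolve_left hs1 (by simpa using h)
    | zero => exact ⟨0, fun v => by simp⟩
    | add s t _ _ hs ht =>
      obtain ⟨a, ha⟩ := hs
      obtain ⟨b, hb⟩ := ht
      exact ⟨a + b, fun v => by rw [add_smul, map_add, ha, hb, add_smul]⟩
    | smul c s _ hs =>
      obtain ⟨a, ha⟩ := hs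
      exact ⟨c * a, fun v => by rw [smul_assoc, map_smul, ha, mul_smul]⟩
  let Φ : Submodule R (LinearMap.range (π n)) → Submodule S N := fun U =>
    Submodule.span S ((fun u : LinearMap.range (π n) => (u : N)) '' U)
  have hmem : ∀ U (u : LinearMap.range (π n)), (u : N) ∈ Φ U → u ∈ U := by
    intro U u hu
    have : ∀ w ∈ Φ U, ∃ u' ∈ U, π n w = (u' : N) := by
      intro w hw
      induction hw using Submodule.closure_induction with
      | zero => exact ⟨0, U.zero_mem, by simp⟩
      | add a b _ _ ha hb =>
        obtain ⟨a', ha', e⟩ := ha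
        obtain ⟨b', hb', e'⟩ := hb
        exact ⟨a' + b', U.add_mem ha' hb', by simp [e, e']⟩
      | smul_mem s w hw =>
        obtain ⟨u', hu', rfl⟩ := hw
        obtain ⟨a, ha⟩ := hs s
        obtain ⟨v, hv⟩ := u'.2
        refine ⟨a • u', U.smul_mem a hu', ?_⟩
        simp only [Submodule.coe_smul]
        rw [← hv, ha]
    obtain ⟨u', hu', e⟩ := this _ hu
    obtain ⟨v, hv⟩ := u.2
    have : u = u' := by
      apply Subtype.ext
      rw [← e, ← hv, hidem]
    rw [this]; exact hu'
  have hmono : Monotone Φ := fun U V h => Submodule.span_mono (Set.image_mono h)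
  have hinj : Function.Injective Φ := by
    have : ∀ U V, Φ U = Φ V → U ≤ V := fun U V h u hu =>
      hmem V u (h ▸ Submodule.subset_span ⟨u, hu, rfl⟩)
    exact fun U V h => le_antisymm (this U V h) (this V U h.symm)
  rw [isNoetherian_iff']
  exact (hmono.strictMono_of_injective hinj).wellFoundedGT

end HilbAux

namespace HilbAux
section kap
universe v₁ u₁ v₂ u₂
variable {C : Type u₁} [Category.{v₁} C] [Abelian C] [HasProjectiveResolutions C]
  {D : Type u₂} [Category.{v₂} D] [Abelian D]

/-- the computation of the derived functor -/
noncomputable def lamIso {X : C} (P : ProjectiveResolution X) (F : C ⥤ D) [F.Additive] (n : ℕ) :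
    (F.leftDerived n).obj X ≅ ((F.mapHomologicalComplex _).obj P.complex).homology n :=
  P.isoLeftDerivedObj F n

/-- the canonical mono from the derived functor to the opcycles -/
noncomputable def kap {X : C} (P : ProjectiveResolution X) (F : C ⥤ D) [F.Additive] (n : ℕ) :
    (F.leftDerived n).obj X ⟶ ((F.mapHomologicalComplex _).obj P.complex).opcycles n :=
  (lamIso P F n).hom ≫ HomologicalComplex.homologyι
    ((F.mapHomologicalComplex _).obj P.complex) n

lemma kap_mono {X : C} (P : ProjectiveResolution X) (F : C ⥤ D) [F.Additive] (n : ℕ) :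
    Mono (kap P F n) := by
  unfold kap
  infer_instance

lemma kap_nat {X : C} (P : ProjectiveResolution X) {F G : C ⥤ D} [F.Additive] [G.Additive]
    (α : F ⟶ G) (n : ℕ) :
    kap P F n ≫ HomologicalComplex.opcyclesMap
      ((NatTrans.mapHomologicalComplex α _).app P.complex) n =
    (NatTrans.leftDerived α n).app X ≫ kap P G n := by
  have h1 : (NatTrans.leftDerived α n).app X = (lamIso P F n).hom ≫
    HomologicalComplex.homologyMap ((NatTrans.mapHomologicalComplex α _).app P.complex) n ≫
      (lamIso P G n).inv := P.leftDerived_app_eq α n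
  rw [h1, kap, kap, Category.assoc, Category.assoc, Category.assoc, Iso.inv_hom_id_assoc,
    HomologicalComplex.homologyι_naturality]

lemma kap_zero {X : C} (P : ProjectiveResolution X) (F : C ⥤ D) [F.Additive] (n : ℕ)
    (g : P.complex ⟶ P.complex) (w : g ≫ P.π = P.π ≫ (ChainComplex.single₀ C).map 0) :
    kap P F n ≫ HomologicalComplex.opcyclesMap ((F.mapHomologicalComplex _).map g) n = 0 := by
  have h1 : (F.leftDerived n).map (0 : X ⟶ X) = (lamIso P F n).hom ≫ 
    HomologicalComplex.homologyMap ((F.mapHomologicalComplex _).map g) n ≫ (lamIso P F n).inv :=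
    F.leftDerived_map_eq n 0 g w
  have h0 : (F.leftDerived n).map (0 : X ⟶ X) = (lamIso P F n).hom ≫ 
    HomologicalComplex.homologyMap ((F.mapHomologicalComplex _).map (0 : P.complex ⟶ P.complex)) n
      ≫ (lamIso P F n).inv :=
    F.leftDerived_map_eq n 0 0 (by simp)
  have h3 : HomologicalComplex.homologyMap ((F.mapHomologicalComplex _).map g) n = 0 := by
    rw [h1, cancel_epi, cancel_mono] at h0
    rw [h0, Functor.map_zero, HomologicalComplex.homologyMap_zero]
  rw [kap, Category.assoc, ← HomologicalComplex.homologyι_naturality, h3, Limits.zero_comp,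
    Limits.comp_zero]
end kap
end HilbAux

namespace HilbAux
variable {R : Type u} [CommRing R] [IsNoetherianRing R]

lemma fg_projective_of_projective (P : FGModuleCat.{u} R) [Module.Projective R P] : Projective P := by
  constructor
  intro E X f e he
  have hsurj : Function.Surjective ((forget₂ (FGModuleCat R) (ModuleCat R)).map e).hom := by
    rw [← ModuleCat.epi_iff_surjective]
    infer_instance
  have : Module.Projective R ((forget₂ (FGModuleCat R) (ModuleCat R)).obj P) :=
    ‹Module.Projective R P›
  obtain ⟨g, hg⟩ := Module.projective_lifting_property
    ((forget₂ (FGModuleCat R) (ModuleCat R)).map e).hom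
    ((forget₂ (FGModuleCat R) (ModuleCat R)).map f).hom hsurj
  refine ⟨FGModuleCat.ofHom g, ?_⟩
  ext v
  exact LinearMap.congr_fun hg v

lemma fg_cover (Z : FGModuleCat.{u} R) : ∃ (P : FGModuleCat.{u} R) (f : P ⟶ Z),
    Module.Free R P ∧ Epi f := by
  obtain ⟨n, f, hf⟩ := Module.Finite.exists_fin' R Z
  let e : ULift.{u} (Fin n → R) ≃ₗ[R] (Fin n → R) := ULift.moduleEquiv
  let g : FGModuleCat.of R (ULift.{u} (Fin n → R)) ⟶ Z := FGModuleCat.ofHom (f ∘ₗ e.toLinearMap)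
  refine ⟨FGModuleCat.of R (ULift.{u} (Fin n → R)), g, ?_, ?_⟩
  · exact Module.Free.of_equiv e.symm
  · apply (forget₂ (FGModuleCat R) (ModuleCat R)).epi_of_epi_map
    rw [ModuleCat.epi_iff_surjective]
    exact hf.comp e.surjective

instance : EnoughProjectives (FGModuleCat.{u} R) where
  presentation Z := by
    obtain ⟨P, f, hP, hf⟩ := fg_cover Z
    have : Projective P := fg_projective_of_projective P
    exact ⟨{ p := P, f := f, projective := this, epi := hf }⟩

instance : (forget₂ (FGModuleCat.{u} R) (ModuleCat.{u} R)).PreservesProjectiveObjects where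
  projective_obj {Z} hZ := by
    obtain ⟨P, f, hP, hf⟩ := fg_cover Z
    let s := Projective.factorThru (𝟙 Z) f
    have hs : s ≫ f = 𝟙 Z := Projective.factorThru_comp _ _
    have hP' : Projective ((forget₂ (FGModuleCat R) (ModuleCat R)).obj P) :=
      (IsProjective.iff_projective (R := R) P).1 inferInstance
    exact (Retract.map ⟨s, f, hs⟩ (forget₂ (FGModuleCat R) (ModuleCat R))).projective

instance : (forget₂ (FGModuleCat.{u} R) (ModuleCat.{u} R)).PreservesHomology := inferInstance

lemma exists_fg_resolution (k : Type u) [AddCommGroup k] [Module R k] [Module.Finite R k] :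
   ∃ P : ProjectiveResolution (ModuleCat.of R k), ∀ n, Module.Finite R (P.complex.X n) := by
  let P := projectiveResolution (FGModuleCat.of R k)
  refine ⟨(forget₂ (FGModuleCat.{u} R) (ModuleCat.{u} R)).mapProjectiveResolution P, fun n => ?_⟩
  exact inferInstanceAs (Module.Finite R (P.complex.X n))

end HilbAux
namespace HilbAux
variable {R : Type u} [CommRing R] [IsNoetherianRing R]

/-- shorthand for Ext of the residue field -/
noncomputable abbrev ExtK (R : Type u) [CommRing R] [IsLocalRing R] (i : ℕ) :
    ModuleCat.{u} R ⥤ ModuleCat.{u} R :=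
  (Ext R (ModuleCat.{u} R) i).obj (Opposite.op (ModuleCat.of R (IsLocalRing.ResidueField R)))

lemma ext_concrete [IsLocalRing R] (i : ℕ) :
    ∃ (Q : ModuleCat.{u} R) (_ : Module.Finite R Q) (Z : ModuleCat.{u} R → ModuleCat.{u} R)
      (j : ∀ Y, Z Y →ₗ[R] (Q →ₗ[R] Y))
      (q : ∀ Y, Z Y →ₗ[R] ((ExtK R i).obj Y)),
      (∀ Y, Function.Injective (j Y)) ∧ (∀ Y, Function.Surjective (q Y)) ∧
      (∀ (Y Y' : ModuleCat.{u} R) (φ : Y ⟶ Y') (z : Z Y), ∃ z' : Z Y', j Y' z' = φ.hom ∘ₗ j Y z ∧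
        q Y' z' = ((ExtK R i).map φ).hom (q Y z)) ∧
      (∀ a ∈ IsLocalRing.maximalIdeal R, ∀ Y, ∀ v : ((ExtK R i).obj Y), a • v = 0) := by
  obtain ⟨P, hP⟩ := exists_fg_resolution (R := R) (IsLocalRing.ResidueField R)
  let F : ModuleCat.{u} R → (ModuleCat.{u} R ⥤ (ModuleCat.{u} R)ᵒᵖ) :=
    fun Y => ((linearYoneda R (ModuleCat.{u} R)).obj Y).rightOp
  have hF : ∀ Y, (F Y).Additive := fun Y => by dsimp [F]; infer_instance
  let Cx : ModuleCat.{u} R → ChainComplex (ModuleCat.{u} R)ᵒᵖ ℕ := fun Y =>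
    ((F Y).mapHomologicalComplex _).obj P.complex
  let h : ∀ Y, ModuleCat.of R (P.complex.X i ⟶ Y) →ₗ[R] (P.complex.X i →ₗ[R] Y) := fun Y =>
    { toFun := fun g => g.hom, map_add' := fun _ _ => rfl, map_smul' := fun _ _ => rfl }
  let j0 : ∀ Y, ((Cx Y).opcycles i).unop ⟶ ModuleCat.of R (P.complex.X i ⟶ Y) :=
    fun Y => ((Cx Y).pOpcycles i).unop
  let q0 : ∀ Y, ((Cx Y).opcycles i).unop ⟶ ((ExtK R i).obj Y) :=
    fun Y => (kap P (F Y) i).unop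
  have hj0 : ∀ Y, Function.Injective (j0 Y).hom := by
    intro Y
    rw [← ModuleCat.mono_iff_injective]
    exact unop_mono_of_epi ((Cx Y).pOpcycles i)
  have hq0 : ∀ Y, Function.Surjective (q0 Y).hom := by
    intro Y
    rw [← ModuleCat.epi_iff_surjective]
    have := kap_mono P (F Y) i
    exact unop_epi_of_mono (kap P (F Y) i)
  have hh : ∀ Y, Function.Injective (h Y) := fun Y g g' e => ModuleCat.hom_ext e
  refine ⟨P.complex.X i, hP i, fun Y => ((Cx Y).opcycles i).unop, fun Y => (h Y) ∘ₗ (j0 Y).hom,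
    fun Y => (q0 Y).hom, fun Y => (hh Y).comp (hj0 Y), hq0, ?_, ?_⟩
  · intro Y Y' φ z
    let α : F Y' ⟶ F Y := ((linearYoneda R (ModuleCat.{u} R)).map φ).rightOp
    let ψ : Cx Y' ⟶ Cx Y := (NatTrans.mapHomologicalComplex α _).app P.complex
    refine ⟨(HomologicalComplex.opcyclesMap ψ i).unop.hom z, ?_, ?_⟩
    · have := congrArg Quiver.Hom.unop (HomologicalComplex.p_opcyclesMap ψ i)
      have := LinearMap.congr_fun (congrArg ModuleCat.Hom.hom this) z
      change h Y' ((j0 Y').hom _) = _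
      refine (congrArg (h Y') this).trans ?_
      rfl
    · have h2 := kap_nat P α i
      exact LinearMap.congr_fun (congrArg (fun t => ModuleCat.Hom.hom (Quiver.Hom.unop t)) h2) z
  · intro a ha Y v
    obtain ⟨z, rfl⟩ := hq0 Y v
    let g : P.complex ⟶ P.complex := a • 𝟙 _
    have hg : g ≫ P.π = P.π ≫ (ChainComplex.single₀ _).map
        (0 : ModuleCat.of R (IsLocalRing.ResidueField R) ⟶ _) := by
      have hk : ∀ w : IsLocalRing.ResidueField R, a • w = 0 := by
        intro w
        rw [Algebra.smul_def]
        have : algebraMap R (IsLocalRing.ResidueField R) a = 0 :=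
          (IsLocalRing.residue_eq_zero_iff a).2 ha
        rw [this, zero_mul]
      rw [Functor.map_zero, Limits.comp_zero]
      apply HomologicalComplex.to_single_hom_ext
      let e := (HomologicalComplex.singleObjXSelf (ComplexShape.down ℕ) 0
        (ModuleCat.of R (IsLocalRing.ResidueField R))).hom
      have he : Mono e := inferInstance
      rw [← cancel_mono e]
      have h9 : ((g ≫ P.π).f 0 ≫ e) = a • (P.π.f 0 ≫ e) := by
        have : (g ≫ P.π) = a • P.π := by
          simp [g]
        rw [this, HomologicalComplex.smul_f_apply, Linear.smul_comp]
      rw [h9, HomologicalComplex.zero_f, Limits.zero_comp]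
      ext v
      exact hk _
    let ψ : Cx Y ⟶ Cx Y := ((F Y).mapHomologicalComplex _).map g
    have h4 : (HomologicalComplex.opcyclesMap ψ i).unop.hom z = a • z := by
      apply hj0 Y
      have := congrArg Quiver.Hom.unop (HomologicalComplex.p_opcyclesMap ψ i)
      have := LinearMap.congr_fun (congrArg ModuleCat.Hom.hom this) z
      refine this.trans ?_
      rw [map_smul]
      apply hh Y
      ext v
      change ((j0 Y).hom z).hom (a • v) = a • ((j0 Y).hom z).hom v
      rw [map_smul]
    have h5 := kap_zero P (F Y) i g hg
    have h6 : (q0 Y).hom ((HomologicalComplex.opcyclesMap ψ i).unop.hom z) = 0 := 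
      LinearMap.congr_fun (congrArg (fun t => ModuleCat.Hom.hom (Quiver.Hom.unop t)) h5) z
    rw [h4, map_smul] at h6
    exact h6
end HilbAux
namespace HilbAux
section coh
variable {R : Type u} [CommRing R] {K L : Type u} [AddCommGroup K] [Module R K]
    [AddCommGroup L] [Module R L] (f : K →ₗ[R] L)
    {X X' X'' : Type u} [AddCommGroup X] [Module R X] [AddCommGroup X'] [Module R X']
    [AddCommGroup X''] [Module R X'']

/-- functoriality of the coherent functor -/
def Fmap (φ : X →ₗ[R] X') : coherentApply f X →ₗ[R] coherentApply f X' :=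
  Submodule.mapQ _ _ (LinearMap.llcomp R K X X' φ) (by
    rintro _ ⟨g, rfl⟩
    exact ⟨φ ∘ₗ g, rfl⟩)

lemma Fmap_mk (φ : X →ₗ[R] X') (g : K →ₗ[R] X) :
    Fmap f φ (Submodule.Quotient.mk g) = Submodule.Quotient.mk (φ ∘ₗ g) := rfl

lemma Fmap_id : Fmap f (LinearMap.id : X →ₗ[R] X) = LinearMap.id := by
  apply LinearMap.ext
  intro v
  obtain ⟨g, rfl⟩ := Submodule.Quotient.mk_surjective _ v
  rfl

lemma Fmap_comp (φ : X →ₗ[R] X') (ψ : X' →ₗ[R] X'') :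
    Fmap f (ψ ∘ₗ φ) = Fmap f ψ ∘ₗ Fmap f φ := by
  apply LinearMap.ext
  intro v
  obtain ⟨g, rfl⟩ := Submodule.Quotient.mk_surjective _ v
  rfl

lemma Fmap_add (φ ψ : X →ₗ[R] X') : Fmap f (φ + ψ) = Fmap f φ + Fmap f ψ := by
  apply LinearMap.ext
  intro v
  obtain ⟨g, rfl⟩ := Submodule.Quotient.mk_surjective _ v
  rw [LinearMap.add_apply, Fmap_mk, Fmap_mk, Fmap_mk, ← Submodule.Quotient.mk_add,
    LinearMap.add_comp]

lemma Fmap_smul (a : R) (φ : X →ₗ[R] X') : Fmap f (a • φ) = a • Fmap f φ := by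
  apply LinearMap.ext
  intro v
  obtain ⟨g, rfl⟩ := Submodule.Quotient.mk_surjective _ v
  rw [LinearMap.smul_apply, Fmap_mk, Fmap_mk, ← Submodule.Quotient.mk_smul,
    LinearMap.smul_comp]

lemma isNoetherian_hom {S : Type u} [CommRing S] [Algebra R S] [Module.Finite R K]
    [Module S X] [IsScalarTower R S X] [IsNoetherian S X] : IsNoetherian S (K →ₗ[R] X) := by
  obtain ⟨n, e, he⟩ := Module.Finite.exists_fin' R K
  let T : (K →ₗ[R] X) →ₗ[S] (Fin n → X) :=
    { toFun := fun g t => g (e (Pi.single t 1))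
      map_add' := fun _ _ => rfl
      map_smul' := fun _ _ => rfl }
  apply isNoetherian_of_injective T
  intro g g' h
  have : g ∘ₗ e = g' ∘ₗ e := by
    apply LinearMap.pi_ext'
    intro t
    apply LinearMap.ext_ring
    exact congrFun h t
  apply LinearMap.ext
  intro v
  obtain ⟨w, rfl⟩ := he v
  exact LinearMap.congr_fun this w

lemma noethF {S : Type u} [CommRing S] [Algebra R S] [Module.Finite R K]
    [Module S X] [IsScalarTower R S X] [IsNoetherian S X] [Module S (coherentApply f X)]
    (hact : ∀ (s : S) (v : coherentApply f X), s • v = Fmap f (Algebra.lsmul R R X s) v) :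
    IsNoetherian S (coherentApply f X) := by
  have : IsNoetherian S (K →ₗ[R] X) := isNoetherian_hom
  let T : (K →ₗ[R] X) →ₗ[S] coherentApply f X :=
    { toFun := fun g => Submodule.Quotient.mk g
      map_add' := fun _ _ => rfl
      map_smul' := fun s g => by
        rw [hact, Fmap_mk]
        rfl }
  apply isNoetherian_of_surjective (f := T)
  exact LinearMap.range_eq_top.2 (Submodule.Quotient.mk_surjective _)
end coh

section ext
variable {R : Type u} [CommRing R] [IsNoetherianRing R] [IsLocalRing R] (i : ℕ)
    {X X' X'' : Type u} [AddCommGroup X] [Module R X] [AddCommGroup X'] [Module R X']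
    [AddCommGroup X''] [Module R X'']

/-- functoriality of Ext -/
noncomputable def Emap (φ : X →ₗ[R] X') :
    (ExtK R i).obj (ModuleCat.of R X) →ₗ[R] (ExtK R i).obj (ModuleCat.of R X') :=
  ((ExtK R i).map (ModuleCat.ofHom φ)).hom

lemma Emap_id : Emap i (LinearMap.id : X →ₗ[R] X) = LinearMap.id := by
  unfold Emap
  rw [ModuleCat.ofHom_id, CategoryTheory.Functor.map_id, ModuleCat.hom_id]

lemma Emap_comp (φ : X →ₗ[R] X') (ψ : X' →ₗ[R] X'') :
    Emap i (ψ ∘ₗ φ) = Emap i ψ ∘ₗ Emap i φ := by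
  unfold Emap
  rw [ModuleCat.ofHom_comp, CategoryTheory.Functor.map_comp, ModuleCat.hom_comp]

lemma Emap_add (φ ψ : X →ₗ[R] X') : Emap i (φ + ψ) = Emap i φ + Emap i ψ := by
  obtain ⟨Q, _, Z, j, q, hj, hq, hn, -⟩ := ext_concrete (R := R) i
  apply LinearMap.ext
  intro v
  obtain ⟨z, rfl⟩ := hq _ v
  obtain ⟨z1, h1, h1'⟩ := hn _ _ (ModuleCat.ofHom φ) z
  obtain ⟨z2, h2, h2'⟩ := hn _ _ (ModuleCat.ofHom ψ) z
  obtain ⟨z3, h3, h3'⟩ := hn _ _ (ModuleCat.ofHom (φ + ψ)) z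
  have h : z3 = z1 + z2 := by
    apply hj
    rw [map_add, h1, h2, h3]
    rfl
  refine h3'.symm.trans ?_
  rw [h, map_add, h1', h2']
  rfl

lemma Emap_smul (a : R) (φ : X →ₗ[R] X') : Emap i (a • φ) = a • Emap i φ := by
  obtain ⟨Q, _, Z, j, q, hj, hq, hn, -⟩ := ext_concrete (R := R) i
  apply LinearMap.ext
  intro v
  obtain ⟨z, rfl⟩ := hq _ v
  obtain ⟨z1, h1, h1'⟩ := hn _ _ (ModuleCat.ofHom φ) z
  obtain ⟨z3, h3, h3'⟩ := hn _ _ (ModuleCat.ofHom (a • φ)) z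
  have h : z3 = a • z1 := by
    apply hj
    rw [map_smul, h1, h3]
    rfl
  refine h3'.symm.trans ?_
  rw [h, map_smul, h1']
  rfl

lemma ext_killed (a : R) (ha : a ∈ IsLocalRing.maximalIdeal R)
    (v : (ExtK R i).obj (ModuleCat.of R X)) : a • v = 0 := by
  obtain ⟨Q, _, Z, j, q, hj, hq, hn, h⟩ := ext_concrete (R := R) i
  exact h a ha _ v

lemma noethE {S : Type u} [CommRing S] [Algebra R S]
    [Module S X] [IsScalarTower R S X] [IsNoetherian S X]
    [Module S ((ExtK R i).obj (ModuleCat.of R X))]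
    (hact : ∀ (s : S) (v : (ExtK R i).obj (ModuleCat.of R X)),
      s • v = Emap i (Algebra.lsmul R R X s) v) :
    IsNoetherian S ((ExtK R i).obj (ModuleCat.of R X)) := by
  obtain ⟨Q, hQ, Z, j, q, hj, hq, hn, -⟩ := ext_concrete (R := R) i
  have : IsNoetherian S (Q →ₗ[R] X) := isNoetherian_hom
  let j' : Z (ModuleCat.of R X) →ₗ[R] (Q →ₗ[R] X) := j (ModuleCat.of R X)
  have hj' : Function.Injective j' := hj _
  let q' : Z (ModuleCat.of R X) →ₗ[R] ((ExtK R i).obj (ModuleCat.of R X)) := q (ModuleCat.of R X)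
  have hs : ∀ (s : S) (z : Z (ModuleCat.of R X)), ∃ z', j' z' = s • j' z ∧ q' z' = s • q' z := by
    intro s z
    obtain ⟨z1, h1, h1'⟩ := hn _ _ (ModuleCat.ofHom (Algebra.lsmul R R X s)) z
    refine ⟨z1, h1, ?_⟩
    rw [hact]
    exact h1'
  let W : Submodule S (Q →ₗ[R] X) :=
    { carrier := Set.range j'
      add_mem' := by
        rintro _ _ ⟨a, rfl⟩ ⟨b, rfl⟩
        exact ⟨a + b, map_add _ _ _⟩
      zero_mem' := ⟨0, map_zero _⟩
      smul_mem' := by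
        rintro s _ ⟨a, rfl⟩
        obtain ⟨z', h, -⟩ := hs s a
        exact ⟨z', h⟩ }
  have hW : ∀ w : W, ∃ z, j' z = w := fun w => w.2
  choose g hg using hW
  let T : W →ₗ[S] ((ExtK R i).obj (ModuleCat.of R X)) :=
    { toFun := fun w => q' (g w)
      map_add' := fun a b => by
        rw [← map_add]
        congr 1
        apply hj'
        rw [map_add, hg, hg, hg]
        rfl
      map_smul' := fun s a => by
        obtain ⟨z', h, h'⟩ := hs s (g a)
        rw [RingHom.id_apply, ← h']
        congr 1
        apply hj'
        rw [h, hg, hg]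
        rfl }
  apply isNoetherian_of_surjective (f := T)
  refine LinearMap.range_eq_top.2 fun v => ?_
  obtain ⟨z, rfl⟩ := hq _ v
  refine ⟨⟨j' z, z, rfl⟩, ?_⟩
  change q' _ = q' z
  congr 1
  apply hj'
  rw [hg]
end ext
end HilbAux
namespace HilbAux
lemma exists_gens {R : Type u} [CommRing R] {r : ℕ}
    (S : Type u) [CommRing S] [Algebra R S] [IsNoetherianRing S]
    (𝒜 : (Fin r → ℕ) → Submodule R S) [GradedAlgebra 𝒜]
    (h0 : 𝒜 0 = 1)
    (hstd : ∀ n : Fin r → ℕ, 𝒜 n = ∏ i, 𝒜 (Pi.single i 1) ^ n i) :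
    ∃ (σ : Type u) (_ : Fintype σ) (x : σ → S) (deg : σ → Fin r),
      (∀ s, x s ∈ 𝒜 (Pi.single (deg s) 1)) ∧ Algebra.adjoin R (Set.range x) = ⊤ := by
  have h1 : ∀ i : Fin r, ∃ T : Finset S, (T : Set S) ⊆ 𝒜 (Pi.single i 1) ∧
      Ideal.span (𝒜 (Pi.single i 1) : Set S) = Ideal.span T := by
    intro i
    exact (Submodule.fg_span_iff_fg_span_finset_subset _).1 (IsNoetherian.noetherian _)
  choose T hT hT' using h1
  refine ⟨Σ i, T i, inferInstance, fun s => s.2, fun s => s.1, fun s => hT _ s.2.2, ?_⟩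
  set A := Algebra.adjoin R (Set.range fun s : Σ i, T i => (s.2 : S)) with hA
  have hgen : ∀ i, 𝒜 (Pi.single i 1) ≤ Subalgebra.toSubmodule A := by
    intro i y hy
    have hy' : y ∈ Ideal.span (T i : Set S) := by
      rw [← hT']; exact Ideal.subset_span hy
    obtain ⟨c, -, hc⟩ := Submodule.mem_span_finset.1 hy'
    have h2 : y = ∑ t ∈ T i, (DirectSum.decompose 𝒜 (c t) 0 : S) * t := by
      conv_lhs => rw [← DirectSum.decompose_of_mem_same 𝒜 hy, ← hc]
      rw [DirectSum.decompose_sum, DFinsupp.finsetSum_apply, AddSubmonoidClass.coe_finsetSum]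
      refine Finset.sum_congr rfl fun t ht => ?_
      have := DirectSum.coe_decompose_mul_add_of_right_mem 𝒜 (i := 0) (a := c t) (hT i ht)
      rw [zero_add] at this
      exact this
    rw [h2]
    refine Submodule.sum_mem _ fun t ht => ?_
    apply A.mul_mem
    · have : (DirectSum.decompose 𝒜 (c t) 0 : S) ∈ (1 : Submodule R S) :=
        h0.le (SetLike.coe_mem _)
      rw [Submodule.mem_one] at this
      obtain ⟨a, ha⟩ := this
      rw [← ha]
      exact A.algebraMap_mem a
    · exact Algebra.subset_adjoin ⟨⟨i, t, ht⟩, rfl⟩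
  have hall : ∀ n, 𝒜 n ≤ Subalgebra.toSubmodule A := by
    intro n
    rw [hstd]
    have hpow : ∀ (M : Submodule R S) (k : ℕ), M ≤ Subalgebra.toSubmodule A →
        M ^ k ≤ Subalgebra.toSubmodule A := by
      intro M k hM
      induction k with
      | zero =>
        rw [pow_zero, Submodule.one_le]
        exact A.one_mem
      | succ k ih =>
        rw [pow_succ]
        exact Submodule.mul_le.2 fun a ha b hb => A.mul_mem (ih ha) (hM hb)
    have : ∀ s : Finset (Fin r), ∏ i ∈ s, 𝒜 (Pi.single i 1) ^ n i ≤ Subalgebra.toSubmodule A := by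
      intro s
      induction s using Finset.induction_on with
      | empty =>
        rw [Finset.prod_empty, Submodule.one_le]
        exact A.one_mem
      | insert a s ha ih =>
        rw [Finset.prod_insert ha]
        exact Submodule.mul_le.2 fun u hu v hv => A.mul_mem (hpow _ _ (hgen a) hu) (ih hv)
    exact this _
  rw [eq_top_iff]
  intro y _
  classical
  rw [← DirectSum.sum_support_decompose 𝒜 y]
  exact Subalgebra.sum_mem _ fun n _ => hall n (SetLike.coe_mem _)
end HilbAux
/-- over a Noetherian local ring `R`, the Bass numbers `μ_R^i(F(ℳ_n))`
of the coherent functor applied to graded components are eventually given by a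
polynomial in `n`. -/
theorem stmt16 {R : Type u} [CommRing R] [IsNoetherianRing R] [IsLocalRing R]
    {r : ℕ} (hr : 1 ≤ r)
    -- the Noetherian standard ℕ^r-graded ring S with S₀ = R
    (S : Type u) [CommRing S] [Algebra R S] [IsNoetherianRing S]
    (hinj : Function.Injective (algebraMap R S))
    (𝒜 : (Fin r → ℕ) → Submodule R S) [GradedAlgebra 𝒜]
    (h0 : 𝒜 0 = 1)
    (hstd : ∀ n : Fin r → ℕ, 𝒜 n = ∏ i, 𝒜 (Pi.single i 1) ^ n i)
    -- the finitely generated ℤ^r-graded S-module ℳ with components ℬ n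
    (ℳ : Type u) [AddCommGroup ℳ] [Module R ℳ] [Module S ℳ]
    [IsScalarTower R S ℳ] [Module.Finite S ℳ]
    (ℬ : (Fin r → ℤ) → Submodule R ℳ) (hdec : DirectSum.Decomposition ℬ)
    (hsmul : ∀ (m : Fin r → ℕ) (n : Fin r → ℤ) (s : S) (x : ℳ),
      s ∈ 𝒜 m → x ∈ ℬ n → s • x ∈ ℬ (fun i => n i + m i))
    -- the coherent functor
    {K L : Type u} [AddCommGroup K] [Module R K] [Module.Finite R K]
    [AddCommGroup L] [Module R L] [Module.Finite R L]
    (f : K →ₗ[R] L) (i : ℕ) :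
    ∃ (c : Fin r → ℕ) (P : MvPolynomial (Fin r) ℚ),
      ∀ n : Fin r → ℤ, (fun i => (c i : ℤ)) ≤ n →
        ∃ m : ℕ,
          bassNumber R i (coherentApply f (ℬ n)) = m ∧
          (m : ℚ) = MvPolynomial.eval (fun i => (n i : ℚ)) P := by
  obtain ⟨σ, _, x, deg, hxmem, hgen⟩ := HilbAux.exists_gens S 𝒜 h0 hstd
  have hnoeth : IsNoetherian S ℳ := isNoetherian_of_isNoetherianRing_of_finite S ℳ
  -- module structure on the coherent functor
  let FA : S →+* Module.End R (coherentApply f ℳ) :=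
    { toFun := fun s => HilbAux.Fmap f (Algebra.lsmul R R ℳ s)
      map_one' := by rw [map_one]; exact HilbAux.Fmap_id f
      map_mul' := fun s t => by rw [map_mul]; exact HilbAux.Fmap_comp f _ _
      map_zero' := by
        rw [map_zero]
        have := HilbAux.Fmap_smul f (0 : R) (0 : ℳ →ₗ[R] ℳ)
        rwa [zero_smul, zero_smul] at this
      map_add' := fun s t => by rw [map_add]; exact HilbAux.Fmap_add f _ _ }
  letI mF : Module S (coherentApply f ℳ) := Module.compHom _ FA
  have hactF : ∀ (s : S) (v : coherentApply f ℳ),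
    s • v = HilbAux.Fmap f (Algebra.lsmul R R ℳ s) v := fun s v => rfl
  have towF : IsScalarTower R S (coherentApply f ℳ) := by
    constructor
    intro a s v
    rw [hactF, hactF, map_smul, HilbAux.Fmap_smul, LinearMap.smul_apply]
  have noethF : IsNoetherian S (coherentApply f ℳ) := HilbAux.noethF f hactF
  let N : Type u := (HilbAux.ExtK R i).obj (ModuleCat.of R (coherentApply f ℳ))
  have hlsF : ∀ s : S, (Algebra.lsmul R R (coherentApply f ℳ) s) =
    HilbAux.Fmap f (Algebra.lsmul R R ℳ s) := fun s => rfl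
  let EA : S →+* Module.End R N :=
    { toFun := fun s => HilbAux.Emap i (Algebra.lsmul R R (coherentApply f ℳ) s)
      map_one' := by rw [map_one]; exact HilbAux.Emap_id i
      map_mul' := fun s t => by rw [map_mul]; exact HilbAux.Emap_comp i _ _
      map_zero' := by
        rw [map_zero]
        have := HilbAux.Emap_smul i (0 : R) (0 : coherentApply f ℳ →ₗ[R] coherentApply f ℳ)
        rwa [zero_smul, zero_smul] at this
      map_add' := fun s t => by rw [map_add]; exact HilbAux.Emap_add i _ _ }
  letI mE : Module S N := Module.compHom _ EA
  have hactE : ∀ (s : S) (v : N),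
    s • v = HilbAux.Emap i (Algebra.lsmul R R (coherentApply f ℳ) s) v := fun s v => rfl
  have towE : IsScalarTower R S N := by
    constructor
    intro a s v
    rw [hactE, hactE, map_smul, HilbAux.Emap_smul, LinearMap.smul_apply]
  have noethE : IsNoetherian S N := HilbAux.noethE i hactE
  -- projections
  let p : ∀ n, ℳ →ₗ[R] ℬ n := fun n => (DirectSum.component R _ _ n) ∘ₗ
    (DirectSum.decomposeLinearEquiv ℬ).toLinearMap
  have hp : ∀ n v, p n v = DirectSum.decompose ℬ v n := fun n v => rfl
  let pr : (Fin r → ℤ) → ℳ →ₗ[R] ℳ := fun n => (ℬ n).subtype ∘ₗ p n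
  have hpr : ∀ n v, pr n v = DirectSum.decompose ℬ v n := fun n v => rfl
  have hsec : ∀ n, p n ∘ₗ (ℬ n).subtype = LinearMap.id := by
    intro n
    apply LinearMap.ext
    intro v
    apply Subtype.ext
    exact DirectSum.decompose_of_mem_same ℬ v.2
  have horth0 : ∀ n m, n ≠ m → pr n ∘ₗ pr m = 0 := by
    intro n m hnm
    apply LinearMap.ext
    intro v
    exact DirectSum.decompose_of_mem_ne ℬ (p m v).2 (Ne.symm hnm)
  have hidem0 : ∀ n, pr n ∘ₗ pr n = pr n := by
    intro n
    apply LinearMap.ext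
    intro v
    exact DirectSum.decompose_of_mem_same ℬ (p n v).2
  have hx0 : ∀ s n, pr (n + Pi.single (deg s) 1) ∘ₗ (Algebra.lsmul R R ℳ (x s)) =
      (Algebra.lsmul R R ℳ (x s)) ∘ₗ pr n := by
    intro s n
    apply LinearMap.ext
    intro v
    induction v using DirectSum.Decomposition.inductionOn ℬ with
    | zero => rw [map_zero, map_zero]
    | add a b ha hb => rw [map_add, map_add, ha, hb]
    | @homogeneous m v =>
      have hmem : x s • (v : ℳ) ∈ ℬ (m + Pi.single (deg s) 1) := by
        have h := hsmul _ _ _ _ (hxmem s) v.2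
        have e : (fun t => m t + ((Pi.single (deg s) 1 : Fin r → ℕ) t : ℤ)) =
            m + Pi.single (deg s) 1 := by
          funext t
          rw [Pi.add_apply]
          congr 1
          by_cases ht : t = deg s
          · subst ht; simp
          · simp [Pi.single_eq_of_ne ht]
        rwa [e] at h
      change pr (n + Pi.single (deg s) 1) (x s • (v : ℳ)) = x s • pr n v
      by_cases hmn : m = n
      · subst hmn
        rw [hpr, hpr, DirectSum.decompose_of_mem_same ℬ hmem,
          DirectSum.decompose_of_mem_same ℬ v.2]
      · rw [hpr, hpr, DirectSum.decompose_of_mem_ne ℬ hmem (fun e => hmn (add_right_cancel e)),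
          DirectSum.decompose_of_mem_ne ℬ v.2 hmn, smul_zero]
  let π : (Fin r → ℤ) → N →ₗ[R] N := fun n => HilbAux.Emap i (HilbAux.Fmap f (pr n))
  have hidem : ∀ n v, π n (π n v) = π n v := by
    intro n v
    change (HilbAux.Emap i (HilbAux.Fmap f (pr n)) ∘ₗ HilbAux.Emap i (HilbAux.Fmap f (pr n))) v = _
    rw [← HilbAux.Emap_comp, ← HilbAux.Fmap_comp, hidem0]
  have horth : ∀ n m v, n ≠ m → π n (π m v) = 0 := by
    intro n m v hnm
    change (HilbAux.Emap i (HilbAux.Fmap f (pr n)) ∘ₗ HilbAux.Emap i (HilbAux.Fmap f (pr m))) v = _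
    rw [← HilbAux.Emap_comp, ← HilbAux.Fmap_comp, horth0 n m hnm]
    have h1 := HilbAux.Fmap_smul f (0 : R) (0 : ℳ →ₗ[R] ℳ)
    rw [zero_smul, zero_smul] at h1
    have h2 := HilbAux.Emap_smul i (0 : R) (0 : coherentApply f ℳ →ₗ[R] coherentApply f ℳ)
    rw [zero_smul, zero_smul] at h2
    rw [h1, h2]
    rfl
  have hx : ∀ s n v, π (n + Pi.single (deg s) 1) (x s • v) = x s • π n v := by
    intro s n v
    rw [hactE, hactE, hlsF]
    change (HilbAux.Emap i (HilbAux.Fmap f (pr _)) ∘ₗ HilbAux.Emap i (HilbAux.Fmap f _)) v =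
      (HilbAux.Emap i (HilbAux.Fmap f _) ∘ₗ HilbAux.Emap i (HilbAux.Fmap f (pr n))) v
    rw [← HilbAux.Emap_comp, ← HilbAux.Fmap_comp, ← HilbAux.Emap_comp, ← HilbAux.Fmap_comp, hx0]
  have hfin : ∀ n, Module.length R (LinearMap.range (π n)) ≠ ⊤ := by
    intro n
    have : IsNoetherian R (LinearMap.range (π n)) :=
      HilbAux.component_finite x deg hgen N π hidem horth hx n
    apply HilbAux.length_ne_top_of_killed
    intro a ha v
    apply Subtype.ext
    exact HilbAux.ext_killed i a ha _
  obtain ⟨c, P, hP⟩ := HilbAux.hilbert x deg hgen _ Finset.univ rfl N π hidem horth hx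
    (fun s hs => absurd (Finset.mem_univ s) hs) hfin
  refine ⟨fun t => (c t).toNat, P, fun n hn => ?_⟩
  have hcn : c ≤ n := fun t => (Int.self_le_toNat _).trans (hn t)
  refine ⟨_, ?_, hP n hcn⟩
  -- comparison of the component
  let B : Type u := (HilbAux.ExtK R i).obj (ModuleCat.of R (coherentApply f (ℬ n)))
  let a : B →ₗ[R] N := HilbAux.Emap i (HilbAux.Fmap f (ℬ n).subtype)
  let b : N →ₗ[R] B := HilbAux.Emap i (HilbAux.Fmap f (p n))
  have hba : b ∘ₗ a = LinearMap.id := by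
    change HilbAux.Emap i (HilbAux.Fmap f (p n)) ∘ₗ
      HilbAux.Emap i (HilbAux.Fmap f (ℬ n).subtype) = _
    rw [← HilbAux.Emap_comp, ← HilbAux.Fmap_comp, hsec, HilbAux.Fmap_id, HilbAux.Emap_id]
  have hab : a ∘ₗ b = π n := by
    change HilbAux.Emap i (HilbAux.Fmap f (ℬ n).subtype) ∘ₗ
      HilbAux.Emap i (HilbAux.Fmap f (p n)) = _
    rw [← HilbAux.Emap_comp, ← HilbAux.Fmap_comp]
  have hba' : ∀ v, b (a v) = v := fun v => LinearMap.congr_fun hba v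
  have ha : Function.Injective a := Function.LeftInverse.injective hba'
  have hb : Function.Surjective b := Function.RightInverse.surjective hba'
  have hr' : LinearMap.range (π n) = LinearMap.range a := by
    rw [← hab]
    exact LinearMap.range_comp_of_range_eq_top _ (LinearMap.range_eq_top.2 hb)
  have hlen : Module.length R B = Module.length R (LinearMap.range (π n)) := by
    rw [hr']
    exact (LinearEquiv.ofInjective a ha).length_eq
  change Order.krullDim (Submodule R B) = _
  rw [← Module.coe_length, hlen, ← ENat.coe_toNat (hfin n)]
  rfl
end

section
/- Let (R, 𝔪) be a commutative Noetherian local ring and r ≥ 1. Let S = ⊕_{n∈ℕ^r} S_n be a Noetherian standard ℕ^r-graded ring with S_0 = R, and let ℳ = ⊕_{n∈ℤ^r} ℳ_n be a finitely generated ℤ^r-graded S-module. Let f : K → L be an R-linear map between finitely generated R-modules and let F denote the associated coherent functor, F(X) := Hom_R(K,X) / {g ∘ f : g ∈ Hom_R(L,X)}. Then the projective dimension of F(ℳ_n) is eventually constant: there exists c ∈ ℕ^r such that for all n ∈ ℤ^r with n ≥ c, pd_R(F(ℳ_n)) = pd_R(F(ℳ_c)) as elements of ℕ ∪ {∞}.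 -/
universe u

open CategoryTheory

/-- The projective dimension `pd_R(X) ∈ ℕ ∪ {∞}` of an `R`-module `X`: the least
`m ∈ ℕ` such that `Ext_R^{m+1}(X, Y) = 0` for every `R`-module `Y` (equivalently, the
least length of a projective resolution of `X`), and `⊤` if there is no such `m`. -/
noncomputable def projDim (R : Type u) [CommRing R]
    (X : Type u) [AddCommGroup X] [Module R X] : ℕ∞ :=
  sInf {n : ℕ∞ | ∃ m : ℕ, n = m ∧ ∀ Y : ModuleCat.{u} R,
    Subsingleton ↥(((Ext R (ModuleCat.{u} R) (m + 1)).obj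
      (Opposite.op (ModuleCat.of R X))).obj Y)}

open TensorProduct

/-- shorthand for projective dimension at most `m` -/
def PD (R : Type u) [CommRing R] (M : Type u) [AddCommGroup M] [Module R M] (m : ℕ) : Prop :=
  HasProjectiveDimensionLE (ModuleCat.of R M) m

lemma ext_iff_PD (R : Type u) [CommRing R] (X : Type u) [AddCommGroup X] [Module R X] (m : ℕ) :
    (∀ Y : ModuleCat.{u} R,
    Subsingleton ↥(((Ext R (ModuleCat.{u} R) (m + 1)).obj
      (Opposite.op (ModuleCat.of R X))).obj Y)) ↔ PD R X m := by
  let P := projectiveResolution (ModuleCat.of R X)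
  have key : ∀ Y : ModuleCat.{u} R, Subsingleton ↥(((Ext R (ModuleCat.{u} R) (m + 1)).obj
      (Opposite.op (ModuleCat.of R X))).obj Y) ↔
      Subsingleton (Abelian.Ext.{u} (ModuleCat.of R X) Y (m + 1)) := by
    intro Y
    rw [← ModuleCat.isZero_iff_subsingleton, (P.isoExt (m + 1) Y).isZero_iff,
      ← HomologicalComplex.exactAt_iff_isZero_homology,
      HomologicalComplex.exactAt_iff' _ m (m+1) (m+2) (by simp) (by simp),
      ShortComplex.moduleCat_exact_iff]
    constructor
    · intro h
      refine subsingleton_of_forall_eq 0 fun α => ?_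
      obtain ⟨g, hg, rfl⟩ := P.extMk_surjective α (m+2) rfl
      rw [P.extMk_eq_zero_iff g (m+2) rfl hg m rfl]
      exact h g hg
    · intro h g hg
      have := (P.extMk_eq_zero_iff g (m+2) rfl hg m rfl).1 (Subsingleton.elim _ _)
      exact this
  simp only [key]
  constructor
  · intro h
    exact hasProjectiveDimensionLT_of_enoughInjectives _ _ h
  · intro h Y
    have : HasProjectiveDimensionLT (ModuleCat.of R X) (m + 1) := h
    exact HasProjectiveDimensionLT.subsingleton _ (m+1) _ le_rfl Y

lemma projDim_congr (R : Type u) [CommRing R] (X Y : Type u) [AddCommGroup X] [Module R X]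
    [AddCommGroup Y] [Module R Y] (h : ∀ m, PD R X m ↔ PD R Y m) :
    projDim R X = projDim R Y := by
  unfold projDim
  simp only [ext_iff_PD, h]

section
variable {R : Type u} [CommRing R]

lemma PD_zero (M : Type u) [AddCommGroup M] [Module R M] : PD R M 0 ↔ Module.Projective R M := by
  unfold PD
  rw [← projective_iff_hasProjectiveDimensionLE_zero]
  exact (IsProjective.iff_projective (R := R) M).symm

lemma PD_mono {M : Type u} [AddCommGroup M] [Module R M] {m n : ℕ} (h : m ≤ n) (hM : PD R M m) :
    PD R M n := by
  have : HasProjectiveDimensionLT (ModuleCat.of R M) (m + 1) := hM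
  exact hasProjectiveDimensionLT_of_ge _ (m+1) (n+1) (by omega)

lemma PD_succ {N G M : Type u} [AddCommGroup M] [Module R M] [AddCommGroup N] [Module R N]
    [AddCommGroup G] [Module R G] (f : N →ₗ[R] G) (g : G →ₗ[R] M) (hf : Function.Injective f)
    (hfg : Function.Exact f g) (hg : Function.Surjective g) [Module.Projective R G] (m : ℕ) :
    PD R M (m+1) ↔ PD R N m := by
  let Sc : ShortComplex (ModuleCat.{u} R) := ShortComplex.mk (ModuleCat.ofHom f) (ModuleCat.ofHom g)
    (by ext x; exact hfg.apply_apply_eq_zero x)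
  have hS : Sc.ShortExact :=
    { exact := (ShortComplex.ShortExact.moduleCat_exact_iff_function_exact Sc).2 hfg
      mono_f := (ModuleCat.mono_iff_injective _).2 hf
      epi_g := (ModuleCat.epi_iff_surjective _).2 hg }
  exact hS.hasProjectiveDimensionLT_X₃_iff m ((IsProjective.iff_projective (R := R) G).1 ‹_›)

lemma PD_coker {N G M : Type u} [AddCommGroup M] [Module R M] [AddCommGroup N] [Module R N]
    [AddCommGroup G] [Module R G] (f : N →ₗ[R] G) (g : G →ₗ[R] M) (hf : Function.Injective f)
    (hfg : Function.Exact f g) (hg : Function.Surjective g) (m : ℕ)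
    (h1 : PD R N m) (h2 : PD R G m) : PD R M (m+1) := by
  let Sc : ShortComplex (ModuleCat.{u} R) := ShortComplex.mk (ModuleCat.ofHom f) (ModuleCat.ofHom g)
    (by ext x; exact hfg.apply_apply_eq_zero x)
  have hS : Sc.ShortExact :=
    { exact := (ShortComplex.ShortExact.moduleCat_exact_iff_function_exact Sc).2 hfg
      mono_f := (ModuleCat.mono_iff_injective _).2 hf
      epi_g := (ModuleCat.epi_iff_surjective _).2 hg }
  exact hS.hasProjectiveDimensionLT_X₃ (m+1) h1 (PD_mono (Nat.le_succ m) h2)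

/-- finite free presentations -/
lemma exists_pres [IsNoetherianRing R] (M : Type u) [AddCommGroup M] [Module R M]
    [Module.Finite R M] : ∃ (a : ℕ) (N : Submodule R (Fin a → R)) (q : (Fin a → R) →ₗ[R] M),
      Function.Surjective q ∧ Function.Exact N.subtype q := by
  obtain ⟨a, q, hq⟩ := Module.Finite.exists_fin' R M
  exact ⟨a, LinearMap.ker q, q, hq, q.exact_subtype_ker_map⟩

lemma square_inj {A F N G : Type u} [AddCommGroup A] [Module R A] [AddCommGroup F] [Module R F]
    [AddCommGroup N] [Module R N] [AddCommGroup G] [Module R G] (j : A →ₗ[R] F) (i : N →ₗ[R] G)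
    (h1 : Function.Injective (i.lTensor F)) (h2 : Function.Injective (j.rTensor N)) :
    Function.Injective (i.lTensor A) := by
  have : (j.rTensor G) ∘ₗ (i.lTensor A) = (i.lTensor F) ∘ₗ (j.rTensor N) := by
    rw [LinearMap.rTensor_comp_lTensor, LinearMap.lTensor_comp_rTensor]
  have h3 : Function.Injective ((j.rTensor G) ∘ₗ (i.lTensor A)) := by
    rw [this]; exact h1.comp h2
  rw [LinearMap.coe_comp] at h3
  exact h3.of_comp

lemma square_inj' {A F N G : Type u} [AddCommGroup A] [Module R A] [AddCommGroup F] [Module R F]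
    [AddCommGroup N] [Module R N] [AddCommGroup G] [Module R G] (j : A →ₗ[R] F) (i : N →ₗ[R] G)
    (h1 : Function.Injective (j.rTensor G)) (h2 : Function.Injective (i.lTensor A)) :
    Function.Injective (j.rTensor N) := by
  have : (j.rTensor G) ∘ₗ (i.lTensor A) = (i.lTensor F) ∘ₗ (j.rTensor N) := by
    rw [LinearMap.rTensor_comp_lTensor, LinearMap.lTensor_comp_rTensor]
  have h3 : Function.Injective ((i.lTensor F) ∘ₗ (j.rTensor N)) := by
    rw [← this]; exact h1.comp h2
  rw [LinearMap.coe_comp] at h3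
  exact h3.of_comp

lemma balance' {A F B N G M : Type u} [AddCommGroup A] [Module R A] [AddCommGroup F] [Module R F]
    [AddCommGroup B] [Module R B] [AddCommGroup M] [Module R M]
    [AddCommGroup N] [Module R N] [AddCommGroup G] [Module R G]
    {j : A →ₗ[R] F} {q : F →ₗ[R] B} {i : N →ₗ[R] G} {p : G →ₗ[R] M}
    (hjq : Function.Exact j q) (hq : Function.Surjective q)
    (hip : Function.Exact i p) (hp : Function.Surjective p)
    (h1 : Function.Injective (i.lTensor B)) (h2 : Function.Injective (j.rTensor G)) :
    Function.Injective (j.rTensor M) := by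
  rw [← LinearMap.lTensor_inj_iff_rTensor_inj] at h2 ⊢
  rw [LinearMap.lTensor_inj_iff_rTensor_inj] at h1
  exact lTensor_injective_of_exact_of_exact_of_rTensor_injective hip hp hjq hq h1 h2

lemma tor_criterion [IsNoetherianRing R] [IsLocalRing R] (m : ℕ) :
    ∃ (a : ℕ) (A : Submodule R (Fin a → R)), ∀ (M : Type u) [AddCommGroup M] [Module R M]
      [Module.Finite R M], PD R M m ↔ Function.Injective (A.subtype.rTensor M) := by
  induction m with
  | zero =>
    obtain ⟨a, A, q, hq, hA⟩ := exists_pres (R := R) (IsLocalRing.ResidueField R)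
    refine ⟨a, A, fun M _ _ _ => ?_⟩
    rw [PD_zero]
    constructor
    · intro h
      exact Module.Flat.rTensor_preserves_injective_linearMap _ A.subtype_injective
    · intro h
      obtain ⟨b, N, p, hp, hN⟩ := exists_pres (R := R) M
      have := Module.free_of_lTensor_residueField_injective _ _ hp hN
        (lTensor_injective_of_exact_of_exact_of_rTensor_injective hA hq hN hp h
          (Module.Flat.lTensor_preserves_injective_linearMap _ N.subtype_injective))
      infer_instance
  | succ m ih =>
    obtain ⟨a, A, hA⟩ := ih
    obtain ⟨b, B, q, hq, hB⟩ := exists_pres (R := R) A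
    refine ⟨b, B, fun M _ _ _ => ?_⟩
    obtain ⟨c, N, p, hp, hN⟩ := exists_pres (R := R) M
    rw [PD_succ N.subtype p N.subtype_injective hN hp, hA]
    constructor
    · intro h
      exact balance' hB hq hN hp (square_inj A.subtype N.subtype
        (Module.Flat.lTensor_preserves_injective_linearMap _ N.subtype_injective) h)
          (Module.Flat.rTensor_preserves_injective_linearMap _ B.subtype_injective)
    · intro h
      refine square_inj' A.subtype N.subtype
        (Module.Flat.rTensor_preserves_injective_linearMap _ A.subtype_injective) ?_
      exact lTensor_injective_of_exact_of_exact_of_rTensor_injective hB hq hN hp h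
        (Module.Flat.lTensor_preserves_injective_linearMap _ N.subtype_injective)

lemma syz_tor [IsNoetherianRing R] (d : ℕ) : ∀ (B : Type u) [AddCommGroup B] [Module R B]
    [Module.Finite R B], PD R B d → ∀ (M : Type u) [AddCommGroup M] [Module R M]
    [Module.Finite R M], ∃ (a : ℕ) (N : Submodule R (Fin a → R)),
      (∀ e, PD R ((Fin a → R) ⧸ N) e ↔ PD R M (d + e)) ∧
      Function.Injective (N.subtype.lTensor B) := by
  induction d with
  | zero =>
    intro B _ _ _ hB M _ _ _
    rw [PD_zero] at hB
    obtain ⟨c, N, p, hp, hN⟩ := exists_pres (R := R) M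
    refine ⟨c, N, fun e => ?_, Module.Flat.lTensor_preserves_injective_linearMap _ N.subtype_injective⟩
    have hk : N = LinearMap.ker p := by
      have := hN.linearMap_ker_eq; simpa using this.symm
    subst hk
    rw [zero_add]
    let e' := p.quotKerEquivOfSurjective hp
    unfold PD
    constructor
    · intro h
      exact hasProjectiveDimensionLT_of_iso e'.toModuleIso _
    · intro h
      exact hasProjectiveDimensionLT_of_iso e'.symm.toModuleIso _
  | succ d ih =>
    intro B _ _ _ hB M _ _ _
    obtain ⟨b, B', q, hq, hB'⟩ := exists_pres (R := R) B
    rw [PD_succ B'.subtype q B'.subtype_injective hB' hq] at hB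
    obtain ⟨a, N, hN, hinj⟩ := ih B' hB M
    obtain ⟨c, N2, p, hp, hN2⟩ := exists_pres (R := R) N
    refine ⟨c, N2, fun e => ?_, ?_⟩
    · have hk : N2 = LinearMap.ker p := by
        have := hN2.linearMap_ker_eq; simpa using this.symm
      subst hk
      have h3 : PD R N e ↔ PD R M (d + 1 + e) := by
        rw [← PD_succ N.subtype N.mkQ N.subtype_injective (LinearMap.exact_subtype_mkQ N)
          N.mkQ_surjective, hN, add_right_comm d 1 e]; rfl
      rw [← h3]
      let e' := p.quotKerEquivOfSurjective hp
      unfold PD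
      constructor
      · intro h
        exact hasProjectiveDimensionLT_of_iso e'.toModuleIso _
      · intro h
        exact hasProjectiveDimensionLT_of_iso e'.symm.toModuleIso _
    · refine lTensor_injective_of_exact_of_exact_of_rTensor_injective hB' hq hN2 hp ?_
        (Module.Flat.lTensor_preserves_injective_linearMap _ N2.subtype_injective)
      exact square_inj' B'.subtype N.subtype
        (Module.Flat.rTensor_preserves_injective_linearMap _ B'.subtype_injective) hinj

lemma exists_Q [IsNoetherianRing R] [IsLocalRing R] :
    ∃ (d : ℕ) (I : Ideal R) (φ : IsLocalRing.ResidueField R →ₗ[R] R ⧸ I),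
      Function.Injective φ ∧ PD R (R ⧸ I) d := by
  let 𝒮 : Set (Ideal R) := {I | I ≠ ⊤ ∧ ∃ d, PD R (R ⧸ I) d}
  have hne : 𝒮.Nonempty := by
    refine ⟨⊥, bot_ne_top, 0, ?_⟩
    rw [PD_zero]
    exact Module.Projective.of_equiv (Submodule.quotEquivOfEqBot (⊥ : Ideal R) rfl).symm
  obtain ⟨I, ⟨hI, d, hd⟩, hmax⟩ := set_has_maximal_iff_noetherian.2 ‹IsNoetherianRing R› 𝒮 hne
  have : Nontrivial (R ⧸ I) := Ideal.Quotient.nontrivial_iff.2 hI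
  -- every element of the maximal ideal is a zero divisor on R/I
  have hz : (IsLocalRing.maximalIdeal R : Set R) ⊆ ⋃ p ∈ associatedPrimes R (R ⧸ I), (p : Set R) := by
    rw [biUnion_associatedPrimes_eq_zero_divisors]
    intro x hx
    by_contra hcon
    simp only [Set.mem_ofPred_eq, not_exists, not_and] at hcon
    have hinj : Function.Injective (LinearMap.lsmul R (R ⧸ I) x) := by
      rw [injective_iff_map_eq_zero]
      intro y hy
      by_contra hy0
      exact hcon y hy0 hy
    have hle : I ≤ I ⊔ Ideal.span {x} := le_sup_left
    refine hmax (I ⊔ Ideal.span {x}) ⟨?_, d + 1, ?_⟩ (lt_of_le_of_ne hle ?_)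
    · intro h
      have : I ⊔ Ideal.span {x} ≤ IsLocalRing.maximalIdeal R :=
        sup_le (IsLocalRing.le_maximalIdeal hI) ((Ideal.span_singleton_le_iff_mem _).2 hx)
      rw [h] at this
      exact (IsLocalRing.maximalIdeal.isMaximal R).ne_top (top_le_iff.1 this)
    · refine PD_coker (LinearMap.lsmul R (R ⧸ I) x) (Submodule.factor hle) hinj ?_
        (Submodule.factor_surjective hle) d hd hd
      intro y
      obtain ⟨y, rfl⟩ := Submodule.Quotient.mk_surjective _ y
      rw [show Submodule.factor hle (Submodule.Quotient.mk y) = Submodule.Quotient.mk y from rfl,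
        Submodule.Quotient.mk_eq_zero]
      constructor
      · intro hy
        obtain ⟨u, hu, v, hv, rfl⟩ := Submodule.mem_sup.1 hy
        obtain ⟨w, rfl⟩ := Ideal.mem_span_singleton'.1 hv
        refine ⟨Submodule.Quotient.mk w, ?_⟩
        rw [LinearMap.lsmul_apply, ← Submodule.Quotient.mk_smul]
        rw [Submodule.Quotient.eq, smul_eq_mul, mul_comm]
        simpa using I.neg_mem hu
      · rintro ⟨w, hw⟩
        obtain ⟨w, rfl⟩ := Submodule.Quotient.mk_surjective _ w
        rw [LinearMap.lsmul_apply, ← Submodule.Quotient.mk_smul, Submodule.Quotient.eq] at hw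
        have : x • w ∈ I ⊔ Ideal.span {x} :=
          Submodule.mem_sup_right (Ideal.mul_mem_right _ _ (Ideal.mem_span_singleton_self x))
        simpa using Submodule.sub_mem _ this (hle hw)
    · intro h
      have hxI : x ∈ I := by
        rw [h]; exact Submodule.mem_sup_right (Ideal.mem_span_singleton_self x)
      have h1 : (LinearMap.lsmul R (R ⧸ I) x) (Submodule.Quotient.mk 1) = 0 := by
        rw [LinearMap.lsmul_apply, ← Submodule.Quotient.mk_smul, Submodule.Quotient.mk_eq_zero]
        simpa using hxI
      have h2 := (injective_iff_map_eq_zero _).1 hinj _ h1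
      rw [Submodule.Quotient.mk_eq_zero] at h2
      exact hI ((Ideal.eq_top_iff_one _).2 h2)
  have hfin : (associatedPrimes R (R ⧸ I)).Finite := associatedPrimes.finite R (R ⧸ I)
  obtain ⟨p, hp, hle⟩ : ∃ p ∈ associatedPrimes R (R ⧸ I), IsLocalRing.maximalIdeal R ≤ p := by
    have := (Ideal.subset_union_prime_finite hfin (f := id) (I := IsLocalRing.maximalIdeal R) ⊤ ⊤ 
      (fun p hp _ _ => hp.1)).1 hz
    exact this
  have hpe : p = IsLocalRing.maximalIdeal R :=
    le_antisymm (IsLocalRing.le_maximalIdeal hp.1.ne_top) hle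
  subst hpe
  obtain ⟨φ, hφ⟩ := ((isAssociatedPrime_iff_exists_injective_linearMap _ (R ⧸ I)).1 hp).2
  exact ⟨d, I, φ, hφ, hd⟩

lemma PD_bound [IsNoetherianRing R] [IsLocalRing R] : ∃ d : ℕ, ∀ (M : Type u) [AddCommGroup M]
    [Module R M] [Module.Finite R M] (m : ℕ), PD R M m → PD R M d := by
  obtain ⟨d, I, φ, hφ, hd⟩ := exists_Q (R := R)
  have step : ∀ (M : Type u) [AddCommGroup M] [Module R M] [Module.Finite R M] (e : ℕ),
      d ≤ e → PD R M (e + 1) → PD R M e := by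
    intro M _ _ _ e he hM
    obtain ⟨a, N, hN, hinj⟩ := syz_tor e (R ⧸ I) (PD_mono he hd) M
    have h1 := (hN 1).2 hM
    have h0 := hN 0
    rw [add_zero] at h0
    rw [← h0, PD_zero]
    rw [show (1:ℕ) = 0 + 1 from rfl, PD_succ N.subtype N.mkQ N.subtype_injective
      (LinearMap.exact_subtype_mkQ N) N.mkQ_surjective, PD_zero] at h1
    have := Module.free_of_lTensor_residueField_injective _ _ N.mkQ_surjective
      (LinearMap.exact_subtype_mkQ N) (square_inj φ N.subtype hinj
        (Module.Flat.rTensor_preserves_injective_linearMap _ hφ))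
    infer_instance
  refine ⟨d, fun M _ _ _ m hm => ?_⟩
  rcases le_total m d with h | h
  · exact PD_mono h hm
  · obtain ⟨k, rfl⟩ := Nat.exists_eq_add_of_le h
    induction k with
    | zero => exact hm
    | succ k ih => exact ih (step M (d + k) (Nat.le_add_right d k) hm) (Nat.le_add_right d k)

end

section graded
set_option linter.unusedSectionVars false
variable {R : Type u} [CommRing R] {r : ℕ} {S : Type u} [CommRing S] [Algebra R S]

/-- An external grading of the `S`-module `T` by `R`-modules `X n`. -/
structure Gr (𝒜 : (Fin r → ℕ) → Submodule R S) (T : Type u) [AddCommGroup T] [Module R T]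
    [Module S T] (X : (Fin r → ℤ) → Type u) [∀ n, AddCommGroup (X n)] [∀ n, Module R (X n)]
    (ι : ∀ n, X n →ₗ[R] T) (p : ∀ n, T →ₗ[R] X n) : Prop where
  left : ∀ n x, p n (ι n x) = x
  orth : ∀ n m x, n ≠ m → p m (ι n x) = 0
  sum : ∀ t, ∃ s : Finset (Fin r → ℤ), t = ∑ n ∈ s, ι n (p n t)
  act : ∀ (m : Fin r → ℕ) (n : Fin r → ℤ) (s : S), s ∈ 𝒜 m → ∀ x : X n,
    s • ι n x = ι (fun i => n i + m i) (p (fun i => n i + m i) (s • ι n x))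

variable (𝒜 : (Fin r → ℕ) → Submodule R S) [GradedAlgebra 𝒜]
variable {T : Type u} [AddCommGroup T] [Module R T] [Module S T]
  {X : (Fin r → ℤ) → Type u} [∀ n, AddCommGroup (X n)] [∀ n, Module R (X n)]
  {ι : ∀ n, X n →ₗ[R] T} {p : ∀ n, T →ₗ[R] X n}


variable {𝒜}

lemma Gr.noeth [IsScalarTower R S T] (h0 : 𝒜 0 = 1) (h : Gr 𝒜 T X ι p) [IsNoetherian S T] (n : Fin r → ℤ) :
    IsNoetherian R (X n) := by
  classical
  let Φ : Submodule R (X n) → Submodule S T := fun W => Submodule.span S (ι n '' W)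
  have hΦ : ∀ W w, ι n w ∈ Φ W → w ∈ W := by
    intro W w hw
    have key : ∀ t ∈ Φ W, p n t ∈ W := by
      intro t ht
      obtain ⟨c, rfl⟩ := (Finsupp.mem_span_iff_linearCombination S _ _).1 ht
      rw [Finsupp.linearCombination_apply, Finsupp.sum, map_sum]
      refine W.sum_mem ?_
      rintro ⟨_, x, hx, rfl⟩ -
      generalize c _ = s
      change p n (s • ι n x) ∈ W
      rw [← DirectSum.sum_support_decompose 𝒜 s, Finset.sum_smul, map_sum]
      refine W.sum_mem fun m _ => ?_
      by_cases hm : m = 0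
      · subst hm
        obtain ⟨a, ha⟩ : ∃ a : R, algebraMap R S a = (DirectSum.decompose 𝒜 s 0 : S) := by
          have : (DirectSum.decompose 𝒜 s 0 : S) ∈ 𝒜 0 := Subtype.prop _
          exact Submodule.mem_one.1 (h0.le this)
        rw [← ha, algebraMap_smul, map_smul, h.left]
        exact W.smul_mem _ hx
      · rw [h.act m n _ (Subtype.prop _) x, h.orth]
        · exact W.zero_mem
        · intro he
          apply hm
          funext i
          have := congrFun he i
          simpa using this
    simpa [h.left] using key _ hw
  have hmono : StrictMono Φ := by
    refine Monotone.strictMono_of_injective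
      (fun W W' hW => Submodule.span_mono (Set.image_mono hW)) ?_
    intro W W' hWW
    have h1 : ∀ W W', Φ W = Φ W' → W ≤ W' := fun W W' he w hw =>
      hΦ W' w (he ▸ Submodule.subset_span ⟨w, hw, rfl⟩)
    exact le_antisymm (h1 _ _ hWW) (h1 _ _ hWW.symm)
  rw [isNoetherian_iff'] 
  exact hmono.wellFoundedGT

lemma mul_split (hstd : ∀ n : Fin r → ℕ, 𝒜 n = ∏ i, 𝒜 (Pi.single i 1) ^ n i)
    (a b : Fin r → ℕ) : 𝒜 (a + b) = 𝒜 a * 𝒜 b := by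
  rw [hstd (a + b), hstd a, hstd b, ← Finset.prod_mul_distrib]
  simp [pow_add]

lemma Gr.persist (hstd : ∀ n : Fin r → ℕ, 𝒜 n = ∏ i, 𝒜 (Pi.single i 1) ^ n i)
    (h : Gr 𝒜 T X ι p) [Module.Finite S T] : ∃ c : Fin r → ℕ, ∀ n n' : Fin r → ℤ,
      (fun i => (c i : ℤ)) ≤ n → n ≤ n' → Subsingleton (X n) → Subsingleton (X n') := by
  classical
  obtain ⟨g, hg⟩ := Module.Finite.fg_top (R := S) (M := T)
  choose s hs using h.sum
  let D : Finset (Fin r → ℤ) := g.biUnion s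
  -- every element of `T` is a sum of multiples of homogeneous elements with degrees in `D`
  have hspan : ∀ t : T, t ∈ Submodule.span S {u : T | ∃ d ∈ D, ∃ x, u = ι d x} := by
    intro t
    have ht : t ∈ Submodule.span S (g : Set T) := by rw [hg]; trivial
    refine Submodule.span_le.2 ?_ ht
    intro u hu
    rw [hs u]
    refine Submodule.sum_mem _ fun d hd => Submodule.subset_span ⟨d, ?_, _, rfl⟩
    exact Finset.mem_biUnion.2 ⟨u, hu, hd⟩
  refine ⟨fun i => D.sup fun d => (d i).toNat, fun n n' hcn hnn' hsub => ?_⟩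
  have hDn : ∀ d ∈ D, d ≤ n := by
    intro d hd i
    have h1 := hcn i
    have h2 : (d i).toNat ≤ D.sup fun d => (d i).toNat :=
      Finset.le_sup (f := fun d : Fin r → ℤ => (d i).toNat) hd
    change d i ≤ n i
    simp only at h1
    have := Int.self_le_toNat (d i)
    omega
  -- products from degree `d` to degree `n'` pass through degree `n`
  have hz : ∀ d ∈ D, ∀ (x : X d) (a : S), p n' (a • ι d x) = 0 := by
    intro d hd x a
    rw [← DirectSum.sum_support_decompose 𝒜 a, Finset.sum_smul, map_sum]
    refine Finset.sum_eq_zero fun m _ => ?_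
    by_cases hm : (fun i => d i + (m i : ℤ)) = n'
    · have hma : (DirectSum.decompose 𝒜 a m : S) ∈ 𝒜 m := Subtype.prop _
      generalize (DirectSum.decompose 𝒜 a m : S) = b at hma
      have hdn := hDn d hd
      let m2 : Fin r → ℕ := fun i => (n i - d i).toNat
      let m1 : Fin r → ℕ := fun i => (n' i - n i).toNat
      have e2 : (fun i => d i + (m2 i : ℤ)) = n := by
        funext i
        have : d i ≤ n i := hdn i
        simp only [m2]
        omega
      have e1 : m = m1 + m2 := by
        funext i
        have h1 : d i ≤ n i := hdn i
        have h2 : n i ≤ n' i := hnn' i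
        have h3 := congrFun hm i
        simp only [m1, m2, Pi.add_apply] at *
        omega
      rw [e1, mul_split hstd] at hma
      refine Submodule.mul_induction_on hma ?_ ?_
      · intro u hu v hv
        rw [mul_smul, h.act m2 d v hv x]
        have : ∀ k (y : X k), k = n → y = 0 := by
          rintro k y rfl; exact Subsingleton.elim _ _
        rw [this _ (p _ _) e2]
        simp
      · intro u v hu hv
        rw [add_smul, map_add, hu, hv, add_zero]
    · rw [h.act m d _ (Subtype.prop _) x, h.orth _ _ _ hm]
  refine subsingleton_of_forall_eq 0 fun y => ?_
  rw [← h.left n' y]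
  obtain ⟨c, hc⟩ := (Finsupp.mem_span_iff_linearCombination S _ _).1 (hspan (ι n' y))
  rw [← hc, Finsupp.linearCombination_apply, Finsupp.sum, map_sum]
  refine Finset.sum_eq_zero ?_
  rintro ⟨_, d, hd, x, rfl⟩ -
  exact hz d hd x _

variable [IsScalarTower R S T]
variable {K L : Type u} [AddCommGroup K] [Module R K] [Module.Finite R K]
    [AddCommGroup L] [Module R L] (f : K →ₗ[R] L)

/-- The functoriality of the coherent functor. -/
noncomputable def cohMap {Y Z : Type u} [AddCommGroup Y] [Module R Y] [AddCommGroup Z] [Module R Z]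
    (g : Y →ₗ[R] Z) : coherentApply f Y →ₗ[R] coherentApply f Z :=
  Submodule.mapQ _ _ (LinearMap.compRight R g) (by
    rintro _ ⟨u, rfl⟩
    exact ⟨g ∘ₗ u, rfl⟩)

variable (S T) in
/-- The `S`-module version of the coherent functor. -/
abbrev cohS : Type u := (K →ₗ[R] T) ⧸ LinearMap.range (LinearMap.lcomp S T f)

variable (S T) in
/-- Comparison of the two versions. -/
noncomputable def cohEquiv : coherentApply f T ≃ₗ[R] cohS S T f :=
  Submodule.Quotient.restrictScalarsEquiv R (LinearMap.range (LinearMap.lcomp S T f))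

lemma Gr.coh (h : Gr 𝒜 T X ι p) :
    Gr 𝒜 (cohS S T f) (fun n => coherentApply f (X n))
      (fun n => (cohEquiv S T f).toLinearMap ∘ₗ cohMap f (ι n))
      (fun n => cohMap f (p n) ∘ₗ (cohEquiv S T f).symm.toLinearMap) where
  left n x := by
    obtain ⟨x, rfl⟩ := Submodule.Quotient.mk_surjective _ x
    simp only [LinearMap.comp_apply, LinearEquiv.coe_coe, LinearEquiv.symm_apply_apply]
    change Submodule.Quotient.mk (p n ∘ₗ ι n ∘ₗ x) = _
    congr 1
    ext k; exact h.left n _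
  orth n m x hnm := by
    obtain ⟨x, rfl⟩ := Submodule.Quotient.mk_surjective _ x
    simp only [LinearMap.comp_apply, LinearEquiv.coe_coe, LinearEquiv.symm_apply_apply]
    change Submodule.Quotient.mk (p m ∘ₗ ι n ∘ₗ x) = Submodule.Quotient.mk 0
    congr 1
    ext k; exact h.orth n m _ hnm
  sum t := by
    classical
    obtain ⟨t, rfl⟩ := Submodule.Quotient.mk_surjective _ t
    obtain ⟨g, hg⟩ := Module.Finite.fg_top (R := R) (M := K)
    choose s hs using h.sum
    let D : Finset (Fin r → ℤ) := g.biUnion fun k => s (t k)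
    have key : t = ∑ n ∈ D, ι n ∘ₗ p n ∘ₗ t := by
      refine LinearMap.ext_on hg fun k hk => ?_
      rw [LinearMap.sum_apply]
      have h1 := hs (t k)
      have h2 : s (t k) ⊆ D := Finset.subset_biUnion_of_mem (fun k => s (t k)) hk
      rw [← Finset.sum_subset h2] 
      · exact h1
      · intro n _ hn
        have : p n (t k) = 0 := by
          rw [h1, map_sum]
          exact Finset.sum_eq_zero fun m hm => h.orth _ _ _ (by rintro rfl; exact hn hm)
        simp [this]
    refine ⟨D, ?_⟩
    conv_lhs => rw [key]
    rw [← Submodule.mkQ_apply, map_sum]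
    rfl
  act m n s hs x := by
    obtain ⟨x, rfl⟩ := Submodule.Quotient.mk_surjective _ x
    change Submodule.Quotient.mk (s • (ι n ∘ₗ x)) =
      Submodule.Quotient.mk (ι _ ∘ₗ p (fun i => n i + m i) ∘ₗ (s • (ι n ∘ₗ x)))
    congr 1
    ext k
    exact h.act m n s hs (x k)

lemma cohS_noeth [IsNoetherian S T] : IsNoetherian S (cohS S T f) := by
  obtain ⟨a, q, hq⟩ := Module.Finite.exists_fin' R K
  let ev : (K →ₗ[R] T) →ₗ[S] (Fin a → T) :=
    { toFun := fun u i => u (q (Pi.single i 1))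
      map_add' := fun _ _ => rfl
      map_smul' := fun _ _ => rfl }
  have hev : Function.Injective ev := by
    intro u v huv
    have : u ∘ₗ q = v ∘ₗ q := by
      ext i
      exact congrFun huv i
    ext k
    obtain ⟨y, rfl⟩ := hq k
    exact LinearMap.congr_fun this y
  have : IsNoetherian S (K →ₗ[R] T) := isNoetherian_of_injective ev hev
  infer_instance

variable {A F : Type u} [AddCommGroup A] [Module R A] [AddCommGroup F] [Module R F]
  (j : A →ₗ[R] F)

lemma tensor_noeth [IsNoetherian S T] [Module.Finite R A] : IsNoetherian S (T ⊗[R] A) := by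
  classical
  obtain ⟨a, q, hq⟩ := Module.Finite.exists_fin' R A
  have : IsNoetherian S (T ⊗[R] (Fin a → R)) :=
    isNoetherian_of_linearEquiv (TensorProduct.piScalarRight R S T (Fin a)).symm
  refine isNoetherian_of_surjective (f := TensorProduct.AlgebraTensorModule.lTensor S T q) ?_
  rw [LinearMap.range_eq_top]
  exact LinearMap.lTensor_surjective T hq

lemma Gr.tensor (A : Type u) [AddCommGroup A] [Module R A] (h : Gr 𝒜 T X ι p) :
    Gr 𝒜 (T ⊗[R] A) (fun n => X n ⊗[R] A) (fun n => (ι n).rTensor A)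
      (fun n => (p n).rTensor A) where
  left n x := by
    rw [← LinearMap.comp_apply, ← LinearMap.rTensor_comp,
      show p n ∘ₗ ι n = LinearMap.id from LinearMap.ext (h.left n)]
    simp
  orth n m x hnm := by
    rw [← LinearMap.comp_apply, ← LinearMap.rTensor_comp,
      show p m ∘ₗ ι n = 0 from LinearMap.ext fun x => h.orth n m x hnm]
    simp
  sum t := by
    classical
    -- strengthened so that it is additive
    have key : ∃ s : Finset (Fin r → ℤ), ∀ s', s ⊆ s' →
        t = ∑ n ∈ s', (ι n).rTensor A ((p n).rTensor A t) := by
      induction t using TensorProduct.induction_on with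
      | zero => exact ⟨∅, fun s' _ => by simp⟩
      | tmul t a =>
        obtain ⟨s, hs⟩ := h.sum t
        refine ⟨s, fun s' hs' => ?_⟩
        have h1 : t = ∑ n ∈ s', ι n (p n t) := by
          rw [← Finset.sum_subset hs']
          · exact hs
          · intro n _ hn
            have : p n t = 0 := by
              rw [hs, map_sum]
              exact Finset.sum_eq_zero fun m hm => h.orth _ _ _ (by rintro rfl; exact hn hm)
            simp [this]
        conv_lhs => rw [h1, TensorProduct.sum_tmul]
        simp
      | add x y hx hy =>
        obtain ⟨s1, h1⟩ := hx
        obtain ⟨s2, h2⟩ := hy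
        refine ⟨s1 ∪ s2, fun s' hs' => ?_⟩
        conv_lhs => rw [h1 s' (Finset.union_subset_left hs'), h2 s' (Finset.union_subset_right hs')]
        simp [Finset.sum_add_distrib]
    obtain ⟨s, hs⟩ := key
    exact ⟨s, hs s subset_rfl⟩
  act m n s hs x := by
    induction x using TensorProduct.induction_on with
    | zero => simp
    | tmul x a =>
      simp only [LinearMap.rTensor_tmul, TensorProduct.smul_tmul']
      rw [← h.act m n s hs x]
    | add x y hx hy =>
      simp only [map_add, smul_add]
      rw [← hx, ← hy]

lemma rTensor_mem_ker {Y Z : Type u} [AddCommGroup Y] [Module R Y] [AddCommGroup Z] [Module R Z]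
    (g : Y →ₗ[R] Z) (x : Y ⊗[R] A) (hx : j.lTensor Y x = 0) :
    j.lTensor Z (g.rTensor A x) = 0 := by
  rw [← LinearMap.comp_apply, LinearMap.lTensor_comp_rTensor, ← LinearMap.rTensor_comp_lTensor,
    LinearMap.comp_apply, hx, map_zero]

lemma Gr.ker (h : Gr 𝒜 T X ι p) :
    Gr 𝒜 (LinearMap.ker (TensorProduct.AlgebraTensorModule.lTensor S T j))
      (fun n => LinearMap.ker (j.lTensor (X n)))
      (fun n => ((ι n).rTensor A).restrict
        (q := (LinearMap.ker (TensorProduct.AlgebraTensorModule.lTensor S T j)).restrictScalars R)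
        (fun x hx => rTensor_mem_ker j (ι n) x hx))
      (fun n => ((p n).rTensor A).restrict
        (p := (LinearMap.ker (TensorProduct.AlgebraTensorModule.lTensor S T j)).restrictScalars R)
        (fun x hx => rTensor_mem_ker j (p n) x hx)) where
  left n x := Subtype.ext ((h.tensor A).left n x.1)
  orth n m x hnm := Subtype.ext ((h.tensor A).orth n m x.1 hnm)
  sum t := by
    obtain ⟨s, hs⟩ := (h.tensor A).sum t.1
    refine ⟨s, Subtype.ext ?_⟩
    rw [AddSubmonoidClass.coe_finsetSum]
    exact hs
  act m n s hs x := Subtype.ext ((h.tensor A).act m n s hs x.1)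

end graded

/-- over a Noetherian local ring `R`, `pd_R(F(ℳ_n))` is eventually
constant. -/
theorem stmt18 {R : Type u} [CommRing R] [IsNoetherianRing R] [IsLocalRing R]
    {r : ℕ} (hr : 1 ≤ r)
    -- the Noetherian standard ℕ^r-graded ring S with S₀ = R
    (S : Type u) [CommRing S] [Algebra R S] [IsNoetherianRing S]
    (hinj : Function.Injective (algebraMap R S))
    (𝒜 : (Fin r → ℕ) → Submodule R S) [GradedAlgebra 𝒜]
    (h0 : 𝒜 0 = 1)
    (hstd : ∀ n : Fin r → ℕ, 𝒜 n = ∏ i, 𝒜 (Pi.single i 1) ^ n i)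
    -- the finitely generated ℤ^r-graded S-module ℳ with components ℬ n
    (ℳ : Type u) [AddCommGroup ℳ] [Module R ℳ] [Module S ℳ]
    [IsScalarTower R S ℳ] [Module.Finite S ℳ]
    (ℬ : (Fin r → ℤ) → Submodule R ℳ) (hdec : DirectSum.Decomposition ℬ)
    (hsmul : ∀ (m : Fin r → ℕ) (n : Fin r → ℤ) (s : S) (x : ℳ),
      s ∈ 𝒜 m → x ∈ ℬ n → s • x ∈ ℬ (fun i => n i + m i))
    -- the coherent functor
    {K L : Type u} [AddCommGroup K] [Module R K] [Module.Finite R K]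
    [AddCommGroup L] [Module R L] [Module.Finite R L]
    (f : K →ₗ[R] L) :
    ∃ c : Fin r → ℕ, ∀ n : Fin r → ℤ, (fun i => (c i : ℤ)) ≤ n →
      projDim R (coherentApply f (ℬ n)) =
      projDim R (coherentApply f (ℬ (fun i => (c i : ℤ)))) := by
  classical
  have hGr : Gr 𝒜 ℳ (fun n => ℬ n) (fun n => (ℬ n).subtype)
      (fun n => DirectSum.component R _ _ n ∘ₗ (DirectSum.decomposeLinearEquiv ℬ).toLinearMap) :=
    { left := fun n x => by
        simp only [LinearMap.comp_apply, LinearEquiv.coe_coe, DirectSum.component]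
        exact Subtype.ext (DirectSum.decompose_of_mem_same ℬ x.2)
      orth := fun n m x hnm => by
        simp only [LinearMap.comp_apply, LinearEquiv.coe_coe, DirectSum.component]
        exact Subtype.ext (DirectSum.decompose_of_mem_ne ℬ x.2 hnm)
      sum := fun t => ⟨_, (DirectSum.sum_support_decompose ℬ t).symm⟩
      act := fun m n s hs x => by
        have := hsmul m n s x hs x.2
        exact (DirectSum.decompose_of_mem_same ℬ this).symm }
  have : IsNoetherian S ℳ := isNoetherian_of_isNoetherianRing_of_finite S ℳ
  have hN1 : IsNoetherian S (cohS S ℳ f) := cohS_noeth f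
  have hF := hGr.coh f
  have hfin : ∀ n, IsNoetherian R (coherentApply f (ℬ n)) := fun n => hF.noeth h0 n
  -- persistence of each bound on the projective dimension
  have hper : ∀ m : ℕ, ∃ c : Fin r → ℕ, ∀ n n' : Fin r → ℤ, (fun i => (c i : ℤ)) ≤ n → n ≤ n' →
      PD R (coherentApply f (ℬ n)) m → PD R (coherentApply f (ℬ n')) m := by
    intro m
    obtain ⟨a, A, hA⟩ := tor_criterion (R := R) m
    have hT : IsNoetherian S (cohS S ℳ f ⊗[R] A) := tensor_noeth
    obtain ⟨c, hc⟩ := (hF.ker A.subtype).persist hstd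
    refine ⟨c, fun n n' h1 h2 h3 => ?_⟩
    rw [hA, ← LinearMap.lTensor_inj_iff_rTensor_inj, ← LinearMap.ker_eq_bot,
      ← Submodule.subsingleton_iff_eq_bot] at h3 ⊢
    exact hc n n' h1 h2 h3
  choose c hc using hper
  obtain ⟨d, hd⟩ := PD_bound (R := R)
  let c0 : Fin r → ℕ := fun i => (Finset.range (d + 1)).sup fun m => c m i
  have hc0 : ∀ m ≤ d, c m ≤ c0 := fun m hm i =>
    Finset.le_sup (f := fun m => c m i) (Finset.mem_range.2 (Nat.lt_succ_of_le hm))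
  let bad : (Fin r → ℕ) → Finset ℕ := fun b => (Finset.range (d + 1)).filter fun m =>
    ¬ PD R (coherentApply f (ℬ (fun i => (b i : ℤ)))) m
  obtain ⟨b, hb, hmin⟩ : ∃ b, c0 ≤ b ∧ ∀ b', c0 ≤ b' → (bad b).card ≤ (bad b').card := by
    have hne : (Set.Ici c0).Nonempty := ⟨c0, Set.mem_Ici.2 le_rfl⟩
    exact ⟨Function.argminOn (fun b => (bad b).card) _ hne, Function.argminOn_mem _ _ hne,
      fun b' hb' => Function.argminOn_le (fun b => (bad b).card) (Set.Ici c0) (a := b') hb'⟩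
  refine ⟨b, fun n hn => ?_⟩
  obtain ⟨b', rfl⟩ : ∃ b' : Fin r → ℕ, n = fun i => (b' i : ℤ) := by
    refine ⟨fun i => (n i).toNat, funext fun i => ?_⟩
    have : (b i : ℤ) ≤ n i := hn i
    simp only
    omega
  have hbb' : b ≤ b' := fun i => by
    have : (b i : ℤ) ≤ b' i := hn i
    exact_mod_cast this
  have hsub : bad b' ⊆ bad b := by
    intro m hm
    simp only [bad, Finset.mem_filter, Finset.mem_range] at hm ⊢
    refine ⟨hm.1, fun h => hm.2 (hc m _ _ (fun i => ?_) hn h)⟩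
    have := ((hc0 m (Nat.le_of_lt_succ hm.1)).trans hb) i
    change (c m i : ℤ) ≤ (b i : ℤ)
    exact_mod_cast this
  have heq : bad b' = bad b := Finset.eq_of_subset_of_card_le hsub (hmin b' (hb.trans hbb'))
  have hle : ∀ m ≤ d, (PD R (coherentApply f (ℬ (fun i => (b' i : ℤ)))) m ↔
      PD R (coherentApply f (ℬ (fun i => (b i : ℤ)))) m) := by
    intro m hm
    have := Finset.ext_iff.1 heq m
    simp only [bad, Finset.mem_filter, Finset.mem_range, Nat.lt_succ_of_le hm, true_and] at this
    exact not_iff_not.1 this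
  refine projDim_congr R _ _ fun m => ?_
  rcases le_total m d with h | h
  · exact hle m h
  · exact ⟨fun h' => PD_mono h ((hle d le_rfl).1 (hd _ m h')),
      fun h' => PD_mono h ((hle d le_rfl).2 (hd _ m h'))⟩
end
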